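/- arXiv:math/0606271 — 6 statements merged into one kernel-verified Lean document; each statement's English description precedes it below -/
import Mathlib

section
/- In the corner e𝓜e equipped with the state ψ_e = ψ(e)^{-1}ψ, the von Neumann subalgebra e𝓝e and the subalgebra Ce = {ce : c ∈ C} are free with respect to ψ_e; that is, ψ_e(y_1⋯y_n) = 0 whenever each y_j lies in (e𝓝e) ∩ ker ψ_e or in (Ce) ∩ ker ψ_e and consecutive y_j lie in different ones. -/
open Filter Topology
open scoped ComplexOrder

/-- Freeness of a pair of subsets `S`, `T` (thought of as the centered parts of two
subalgebras) with respect to a functional `φ`: `φ` vanishes on every nontrivial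
alternating product with factors taken alternately from `S` and from `T`. -/
def FreeOn {A R : Type*} [Monoid A] [Zero R] (φ : A → R) (S T : Set A) : Prop :=
  ∀ (n : ℕ) (y : Fin (n + 1) → A) (c : Fin (n + 1) → Bool),
    (∀ i, (c i = true → y i ∈ S) ∧ (c i = false → y i ∈ T)) →
    (∀ i : Fin n, c i.castSucc ≠ c i.succ) →
    φ (List.ofFn y).prod = 0

section StrongSpan

variable {H : Type*} [NormedAddCommGroup H] [InnerProductSpace ℂ H]

/-- A subspace of operators which contains the limits of its strongly convergent sequences. -/
def IsSeqStrongClosed (V : Submodule ℂ (H →L[ℂ] H)) : Prop :=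
  ∀ (R : ℕ → H →L[ℂ] H) (w : H →L[ℂ] H), (∀ k, R k ∈ V) →
    (∀ ξ : H, Tendsto (fun k => R k ξ) atTop (𝓝 (w ξ))) → w ∈ V

/-- The smallest subspace of operators containing `S` and closed under strong limits of
sequences. -/
def strongSpan (S : Set (H →L[ℂ] H)) : Submodule ℂ (H →L[ℂ] H) :=
  sInf {V | IsSeqStrongClosed V ∧ S ⊆ V}

theorem subset_strongSpan (S : Set (H →L[ℂ] H)) : S ⊆ strongSpan S := fun x hx => by
  simp only [strongSpan, SetLike.mem_coe, Submodule.mem_sInf]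
  exact fun V hV => hV.2 hx

theorem isSeqStrongClosed_strongSpan (S : Set (H →L[ℂ] H)) :
    IsSeqStrongClosed (strongSpan S) := by
  intro R w hR hw
  simp only [strongSpan, Submodule.mem_sInf] at hR ⊢
  exact fun V hV => hV.1 R w (fun k => hR k V hV) hw

theorem strongSpan_le {S : Set (H →L[ℂ] H)} {V : Submodule ℂ (H →L[ℂ] H)}
    (hV : IsSeqStrongClosed V) (hS : S ⊆ V) : strongSpan S ≤ V :=
  sInf_le ⟨hV, hS⟩

theorem IsSeqStrongClosed.mem_of_tendsto {V : Submodule ℂ (H →L[ℂ] H)}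
    (hV : IsSeqStrongClosed V) {R : ℕ → H →L[ℂ] H} {w : H →L[ℂ] H} (hR : ∀ k, R k ∈ V)
    (hw : Tendsto R atTop (𝓝 w)) : w ∈ V :=
  hV R w hR fun ξ => ((ContinuousLinearMap.apply ℂ H ξ).continuous.tendsto w).comp hw

theorem IsSeqStrongClosed.closure_subset {V : Submodule ℂ (H →L[ℂ] H)}
    (hV : IsSeqStrongClosed V) {S : Set (H →L[ℂ] H)} (hS : S ⊆ V) : closure S ⊆ V := by
  intro w hw
  obtain ⟨R, hR, hlim⟩ := mem_closure_iff_seq_limit.1 hw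
  exact hV.mem_of_tendsto (fun k => hS (hR k)) hlim

theorem IsSeqStrongClosed.comap_mulLeft {V : Submodule ℂ (H →L[ℂ] H)}
    (hV : IsSeqStrongClosed V) (y : H →L[ℂ] H) :
    IsSeqStrongClosed (V.comap (LinearMap.mulLeft ℂ y)) := fun R w hR hw =>
  hV (fun k => y * R k) (y * w) hR fun ξ => (y.continuous.tendsto _).comp (hw ξ)

theorem IsSeqStrongClosed.comap_mulRight {V : Submodule ℂ (H →L[ℂ] H)}
    (hV : IsSeqStrongClosed V) (y : H →L[ℂ] H) :
    IsSeqStrongClosed (V.comap (LinearMap.mulRight ℂ y)) := fun R w hR hw =>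
  hV (fun k => R k * y) (w * y) hR fun ξ => hw (y ξ)

theorem mul_mem_strongSpan {S T U : Set (H →L[ℂ] H)}
    (h : ∀ y ∈ S, ∀ z ∈ T, y * z ∈ strongSpan U) {y z : H →L[ℂ] H}
    (hy : y ∈ strongSpan S) (hz : z ∈ strongSpan T) : y * z ∈ strongSpan U := by
  have h1 : ∀ y ∈ S, y * z ∈ strongSpan U := fun y hy =>
    strongSpan_le ((isSeqStrongClosed_strongSpan U).comap_mulLeft y) (h y hy) hz
  exact strongSpan_le ((isSeqStrongClosed_strongSpan U).comap_mulRight z) h1 hy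

theorem exists_norm_le_of_strong_tendsto [CompleteSpace H] {R : ℕ → H →L[ℂ] H} {w : H →L[ℂ] H}
    (hw : ∀ ξ : H, Tendsto (fun k => R k ξ) atTop (𝓝 (w ξ))) : ∃ c, ∀ k, ‖R k‖ ≤ c := by
  refine banach_steinhaus fun ξ => ?_
  obtain ⟨c, hc⟩ := (hw ξ).norm.bddAbove_range
  exact ⟨c, fun k => hc ⟨k, rfl⟩⟩

theorem isSeqStrongClosed_vonNeumannAlgebra [CompleteSpace H] (M : VonNeumannAlgebra H) :
    IsSeqStrongClosed M.toStarSubalgebra.toSubalgebra.toSubmodule := by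
  intro R w hR hw
  change w ∈ M
  rw [← M.commutant_commutant, VonNeumannAlgebra.mem_commutant_iff]
  intro g hg
  ext ξ
  have h1 : Tendsto (fun k => R k (g ξ)) atTop (𝓝 (g (w ξ))) := by
    refine ((g.continuous.tendsto _).comp (hw ξ)).congr fun k => ?_
    exact (congrArg (fun T : H →L[ℂ] H => T ξ)
      (VonNeumannAlgebra.mem_commutant_iff.1 hg (R k) (hR k))).symm
  exact tendsto_nhds_unique h1 (hw (g ξ))

end StrongSpan

section BicommutantDensity

variable {H : Type*} [NormedAddCommGroup H] [InnerProductSpace ℂ H]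

/-- The diagonal action of an operator on a finite power of a Hilbert space. -/
noncomputable def diagOp (n : ℕ) (T : H →L[ℂ] H) :
    PiLp 2 (fun _ : Fin n => H) →L[ℂ] PiLp 2 (fun _ : Fin n => H) :=
  (PiLp.continuousLinearEquiv 2 ℂ (fun _ : Fin n => H)).symm.toContinuousLinearMap ∘L
    ContinuousLinearMap.pi fun i => T ∘L PiLp.proj 2 (fun _ : Fin n => H) i

@[simp]
theorem diagOp_apply (n : ℕ) (T : H →L[ℂ] H) (v : PiLp 2 (fun _ : Fin n => H)) (i : Fin n) :
    diagOp n T v i = T (v i) := rfl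

theorem sum_inner_append_diagOp (n : ℕ) (T : H →L[ℂ] H) (v η : PiLp 2 (fun _ : Fin n => H)) :
    inner ℂ (WithLp.toLp 2 (Fin.append η v) : PiLp 2 (fun _ : Fin (n + n) => H))
      (diagOp (n + n) T (WithLp.toLp 2 (Fin.append v η))) =
    inner ℂ η (diagOp n T v) + inner ℂ v (diagOp n T η) := by
  simp only [PiLp.inner_apply, Fin.sum_univ_add, diagOp_apply, Fin.append_left, Fin.append_right]

variable [CompleteSpace H]

theorem inner_diagOp_left (n : ℕ) (T : H →L[ℂ] H) (v w : PiLp 2 (fun _ : Fin n => H)) :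
    inner ℂ (diagOp n T v) w = inner ℂ v (diagOp n (star T) w) := by
  simp [PiLp.inner_apply, ContinuousLinearMap.star_eq_adjoint,
    ContinuousLinearMap.adjoint_inner_right]

/-- The diagonal orbit of a vector under a star subalgebra. -/
noncomputable def diagOrbit (n : ℕ) (S : StarSubalgebra ℂ (H →L[ℂ] H))
    (v : PiLp 2 (fun _ : Fin n => H)) : Submodule ℂ (PiLp 2 (fun _ : Fin n => H)) :=
  S.toSubalgebra.toSubmodule.map
    ({ toFun := fun T => diagOp n T v
       map_add' := fun _ _ => by ext; simp
       map_smul' := fun _ _ => by ext; simp } :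
      (H →L[ℂ] H) →ₗ[ℂ] PiLp 2 (fun _ : Fin n => H))

theorem starProjection_commute_of_invariant {E : Type*} [NormedAddCommGroup E]
    [InnerProductSpace ℂ E] (K : Submodule ℂ E) [K.HasOrthogonalProjection] {T T' : E →L[ℂ] E}
    (hadj : ∀ v w, inner ℂ (T v) w = inner ℂ v (T' w)) (hT : ∀ v ∈ K, T v ∈ K)
    (hT' : ∀ v ∈ K, T' v ∈ K) (v : E) : K.starProjection (T v) = T (K.starProjection v) := by
  refine Submodule.eq_starProjection_of_mem_orthogonal' (z := T (v - K.starProjection v))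
    (hT _ (K.starProjection_apply_mem v)) ?_ (by simp)
  rw [Submodule.mem_orthogonal']
  intro u hu
  rw [hadj]
  exact (Submodule.mem_orthogonal' _ _).1 (K.sub_starProjection_mem_orthogonal v) _ (hT' u hu)

/-- The finite-amplification form of the double commutant theorem. -/
theorem diagOp_mem_closure_diagOrbit (n : ℕ) (S : StarSubalgebra ℂ (H →L[ℂ] H))
    {h : H →L[ℂ] H} (hh : h ∈ Set.centralizer (Set.centralizer (S : Set (H →L[ℂ] H))))
    (v : PiLp 2 (fun _ : Fin n => H)) :
    diagOp n h v ∈ (diagOrbit n S v).topologicalClosure := by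
  set K := (diagOrbit n S v).topologicalClosure with hK
  have : CompleteSpace K := (Submodule.isClosed_topologicalClosure _).completeSpace_coe
  have hinv : ∀ T ∈ S, ∀ w ∈ K, diagOp n T w ∈ K := by
    intro T hT w hw
    refine map_mem_closure (diagOp n T).continuous hw ?_
    rintro _ ⟨U, hU, rfl⟩
    exact ⟨T * U, S.mul_mem hT hU, rfl⟩
  have hcomm : ∀ T ∈ S, ∀ w, K.starProjection (diagOp n T w) = diagOp n T (K.starProjection w) :=
    fun T hT w => starProjection_commute_of_invariant K (inner_diagOp_left n T) (hinv T hT)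
      (hinv _ (star_mem hT)) w
  let p : Fin n → Fin n → H →L[ℂ] H := fun i j =>
    PiLp.proj 2 (fun _ : Fin n => H) i ∘L K.starProjection ∘L
      (PiLp.continuousLinearEquiv 2 ℂ (fun _ : Fin n => H)).symm.toContinuousLinearMap ∘L
        ContinuousLinearMap.single ℂ (fun _ : Fin n => H) j
  have hp : ∀ i j x, p i j x = K.starProjection (PiLp.single 2 j x) i := fun i j x => rfl
  have hdiag : ∀ (T : H →L[ℂ] H) j x, diagOp n T (PiLp.single 2 j x) = PiLp.single 2 j (T x) := by
    intro T j x
    ext i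
    by_cases hij : i = j
    · subst hij; simp
    · simp [hij]
  have hpS : ∀ i j, p i j ∈ Set.centralizer (S : Set (H →L[ℂ] H)) := by
    intro i j T hT
    ext x
    change T (p i j x) = p i j (T x)
    rw [hp, hp, ← hdiag, hcomm T hT, diagOp_apply]
  have hph : ∀ i j x, h (p i j x) = p i j (h x) := fun i j x =>
    (congrArg (fun T : H →L[ℂ] H => T x) (hh _ (hpS i j))).symm
  have hcommh : ∀ w, K.starProjection (diagOp n h w) = diagOp n h (K.starProjection w) := by
    intro w
    have hw : w = ∑ j, PiLp.single 2 j (w j) := by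
      ext i
      simp [WithLp.ofLp_sum, Finset.sum_apply, Pi.single_apply]
    rw [hw]
    simp only [map_sum]
    refine Finset.sum_congr rfl fun j _ => ?_
    ext i
    rw [hdiag, ← hp, diagOp_apply, ← hp, hph]
  have hv : v ∈ K := subset_closure ⟨1, one_mem S, by ext; simp⟩
  rw [← Submodule.starProjection_eq_self_iff] at hv
  rw [← Submodule.starProjection_eq_self_iff, hcommh, hv]

theorem sum_inner_eq_zero_of_bicommutant {n : ℕ} {S : StarSubalgebra ℂ (H →L[ℂ] H)}
    {h : H →L[ℂ] H} (hh : h ∈ Set.centralizer (Set.centralizer (S : Set (H →L[ℂ] H))))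
    (v w : PiLp 2 (fun _ : Fin n => H)) (hvw : ∀ T ∈ S, inner ℂ w (diagOp n T v) = 0) :
    inner ℂ w (diagOp n h v) = 0 := by
  have h1 := diagOp_mem_closure_diagOrbit n S hh v
  have h2 : (diagOrbit n S v).topologicalClosure ≤ (ℂ ∙ w)ᗮ := by
    refine Submodule.topologicalClosure_minimal _ ?_ (Submodule.isClosed_orthogonal _)
    rintro _ ⟨T, hT, rfl⟩
    exact Submodule.mem_orthogonal_singleton_iff_inner_right.2 (hvw T hT)
  exact Submodule.mem_orthogonal_singleton_iff_inner_right.1 (h2 h1)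

/-- Self-adjoint elements of the double commutant are approximated at finitely many vectors by
self-adjoint elements of the star subalgebra. -/
theorem exists_isSelfAdjoint_diagOp_dist_lt (n : ℕ) (S : StarSubalgebra ℂ (H →L[ℂ] H))
    {h : H →L[ℂ] H} (hh : h ∈ Set.centralizer (Set.centralizer (S : Set (H →L[ℂ] H))))
    (hsa : star h = h) (v : PiLp 2 (fun _ : Fin n => H)) {ε : ℝ} (hε : 0 < ε) :
    ∃ k ∈ S, star k = k ∧ dist (diagOp n h v) (diagOp n k v) < ε := by
  let : InnerProductSpace ℝ (PiLp 2 (fun _ : Fin n => H)) := InnerProductSpace.complexToReal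
  let K : Submodule ℝ (PiLp 2 (fun _ : Fin n => H)) :=
    { carrier := {w | ∃ T ∈ S, star T = T ∧ diagOp n T v = w}
      zero_mem' := ⟨0, zero_mem S, star_zero _, by ext; simp⟩
      add_mem' := by
        rintro _ _ ⟨T, hT, hTs, rfl⟩ ⟨U, hU, hUs, rfl⟩
        exact ⟨T + U, add_mem hT hU, by rw [star_add, hTs, hUs], by ext; simp⟩
      smul_mem' := by
        rintro c _ ⟨T, hT, hTs, rfl⟩
        exact ⟨(c : ℂ) • T, S.smul_mem hT _, by rw [star_smul, hTs]; simp, by ext; simp⟩ }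
  suffices hmem : diagOp n h v ∈ K.topologicalClosure by
    obtain ⟨_, ⟨k, hk, hks, rfl⟩, hd⟩ := Metric.mem_closure_iff.1 hmem ε hε
    exact ⟨k, hk, hks, hd⟩
  have hsymm : ∀ (T : H →L[ℂ] H), star T = T → ∀ η : PiLp 2 (fun _ : Fin n => H),
      inner ℂ η (diagOp n T v) + inner ℂ v (diagOp n T η) =
        ((2 * (inner ℂ (diagOp n T v) η).re : ℝ) : ℂ) := by
    intro T hT η
    have h1 : inner ℂ v (diagOp n T η) = inner ℂ (diagOp n T v) η := by
      rw [inner_diagOp_left, hT]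
    rw [h1, ← inner_conj_symm, add_comm, Complex.add_conj]
  rw [← Submodule.orthogonal_orthogonal_eq_closure, Submodule.mem_orthogonal']
  intro η hη
  have hη' : ∀ T ∈ S, star T = T → (inner ℂ (diagOp n T v) η).re = 0 := fun T hT hTs =>
    (Submodule.mem_orthogonal _ _).1 hη _ ⟨T, hT, hTs, rfl⟩
  let f : (H →L[ℂ] H) →ₗ[ℂ] ℂ :=
    { toFun := fun T => inner ℂ η (diagOp n T v) + inner ℂ v (diagOp n T η)
      map_add' := fun T U => by
        have h1 : ∀ w, diagOp n (T + U) w = diagOp n T w + diagOp n U w := fun w => by ext; simp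
        simp only [h1, inner_add_right]; ring
      map_smul' := fun c T => by
        have h1 : ∀ w, diagOp n (c • T) w = c • diagOp n T w := fun w => by ext; simp
        simp only [h1, inner_smul_right, RingHom.id_apply, smul_eq_mul]; ring }
  have hf : ∀ T, f T = inner ℂ η (diagOp n T v) + inner ℂ v (diagOp n T η) := fun _ => rfl
  have hfs : ∀ T ∈ S, star T = T → f T = 0 := fun T hT hTs => by
    rw [hf, hsymm T hTs, hη' T hT hTs]; simp
  have hfS : ∀ T ∈ S, f T = 0 := by
    intro T hT
    have h1 := hfs (T + star T) (add_mem hT (star_mem hT)) (by simp [add_comm])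
    have h2 := hfs (Complex.I • (T - star T)) (S.smul_mem (sub_mem hT (star_mem hT)) _)
      (by rw [star_smul, star_sub, star_star]; simp [← smul_neg])
    rw [map_add] at h1
    rw [map_smul, map_sub, smul_eq_zero, or_iff_right Complex.I_ne_zero] at h2
    linear_combination (h1 + h2) / 2
  have hfh : f h = 0 := by
    rw [hf, ← sum_inner_append_diagOp]
    refine sum_inner_eq_zero_of_bicommutant hh _ _ fun T hT => ?_
    rw [sum_inner_append_diagOp]
    exact hfS T hT
  rw [hf, hsymm h hsa, Complex.ofReal_eq_zero] at hfh
  change (inner ℂ (diagOp n h v) η).re = 0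
  linarith

/-- Self-adjoint elements of the double commutant are limits, at countably many vectors, of
sequences of self-adjoint elements of the star subalgebra. -/
theorem exists_seq_isSelfAdjoint_tendsto (S : StarSubalgebra ℂ (H →L[ℂ] H))
    {h : H →L[ℂ] H} (hh : h ∈ Set.centralizer (Set.centralizer (S : Set (H →L[ℂ] H))))
    (hsa : star h = h) (ζ : ℕ → H) :
    ∃ k : ℕ → H →L[ℂ] H, (∀ n, k n ∈ S ∧ star (k n) = k n) ∧
      ∀ j, Tendsto (fun n => k n (ζ j)) atTop (𝓝 (h (ζ j))) := by
  have key : ∀ n : ℕ, ∃ k ∈ S, star k = k ∧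
      dist (diagOp n h (WithLp.toLp 2 fun i : Fin n => ζ i))
        (diagOp n k (WithLp.toLp 2 fun i : Fin n => ζ i)) < 1 / ((n : ℝ) + 1) :=
    fun n => exists_isSelfAdjoint_diagOp_dist_lt n S hh hsa _ (by positivity)
  choose k hkS hks hkd using key
  refine ⟨k, fun n => ⟨hkS n, hks n⟩, fun j => ?_⟩
  refine squeeze_zero_norm' ?_ tendsto_one_div_add_atTop_nhds_zero_nat |> tendsto_sub_nhds_zero_iff.1
  filter_upwards [eventually_gt_atTop j] with n hn
  refine le_trans ?_ (hkd n).le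
  rw [dist_comm, dist_eq_norm]
  exact PiLp.norm_apply_le (diagOp n (k n) (WithLp.toLp 2 fun i : Fin n => ζ i) -
    diagOp n h (WithLp.toLp 2 fun i : Fin n => ζ i)) ⟨j, hn⟩

end BicommutantDensity

section Resolvent

variable {H : Type*} [NormedAddCommGroup H] [InnerProductSpace ℂ H] [CompleteSpace H]

theorem isUnit_add_I {T : H →L[ℂ] H} (hT : star T = T) :
    IsUnit (T + algebraMap ℂ (H →L[ℂ] H) Complex.I) := by
  have h : -Complex.I ∉ spectrum ℂ T := fun hmem => by
    simpa using IsSelfAdjoint.im_eq_zero_of_mem_spectrum hT hmem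
  rw [spectrum.notMem_iff] at h
  simpa [add_comm, sub_eq_add_neg] using h.neg

theorem norm_le_norm_add_I_apply {T : H →L[ℂ] H} (hT : star T = T) (x : H) :
    ‖x‖ ≤ ‖(T + algebraMap ℂ (H →L[ℂ] H) Complex.I) x‖ := by
  have hreal : (inner ℂ x (T x)).im = 0 := by
    rw [← Complex.conj_eq_iff_im, inner_conj_symm]
    nth_rewrite 1 [← hT]
    rw [ContinuousLinearMap.star_eq_adjoint, ContinuousLinearMap.adjoint_inner_left]
  have him : (inner ℂ x ((T + algebraMap ℂ (H →L[ℂ] H) Complex.I) x)).im = ‖x‖ ^ 2 := by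
    have h1 : (T + algebraMap ℂ (H →L[ℂ] H) Complex.I) x = T x + Complex.I • x := by
      simp [Algebra.algebraMap_eq_smul_one]
    rw [h1, inner_add_right, inner_smul_right, inner_self_eq_norm_sq_to_K, Complex.add_im, hreal]
    simp [← Complex.ofReal_pow]
  have hle : ‖x‖ ^ 2 ≤ ‖x‖ * ‖(T + algebraMap ℂ (H →L[ℂ] H) Complex.I) x‖ :=
    calc ‖x‖ ^ 2 = _ := him.symm
      _ ≤ |_| := le_abs_self _
      _ ≤ _ := Complex.abs_im_le_norm _
      _ ≤ _ := norm_inner_le_norm _ _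
  rcases (norm_nonneg x).eq_or_lt with h0 | h0
  · rw [← h0]; exact norm_nonneg _
  · nlinarith

/-- The operator `(T + i)⁻¹`. -/
noncomputable def resolventI (T : H →L[ℂ] H) : H →L[ℂ] H :=
  Ring.inverse (T + algebraMap ℂ (H →L[ℂ] H) Complex.I)

theorem add_I_mul_resolventI {T : H →L[ℂ] H} (hT : star T = T) :
    (T + algebraMap ℂ (H →L[ℂ] H) Complex.I) * resolventI T = 1 :=
  Ring.mul_inverse_cancel _ (isUnit_add_I hT)

theorem resolventI_mul_add_I {T : H →L[ℂ] H} (hT : star T = T) :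
    resolventI T * (T + algebraMap ℂ (H →L[ℂ] H) Complex.I) = 1 :=
  Ring.inverse_mul_cancel _ (isUnit_add_I hT)

theorem norm_resolventI_apply_le {T : H →L[ℂ] H} (hT : star T = T) (x : H) :
    ‖resolventI T x‖ ≤ ‖x‖ := by
  refine (norm_le_norm_add_I_apply hT (resolventI T x)).trans_eq ?_
  exact congrArg (fun U : H →L[ℂ] H => ‖U x‖) (add_I_mul_resolventI hT)

theorem resolventI_sub_resolventI {T U : H →L[ℂ] H} (hT : star T = T) (hU : star U = U) :
    resolventI T - resolventI U = resolventI T * ((U - T) * resolventI U) := by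
  calc resolventI T - resolventI U
      = resolventI T * ((U + algebraMap ℂ (H →L[ℂ] H) Complex.I) * resolventI U) -
        (resolventI T * (T + algebraMap ℂ (H →L[ℂ] H) Complex.I)) * resolventI U := by
          rw [add_I_mul_resolventI hU, resolventI_mul_add_I hT, mul_one, one_mul]
    _ = _ := by noncomm_ring

theorem resolventI_mul_comm {T U : H →L[ℂ] H} (hT : star T = T) (hTU : T * U = U * T) :
    resolventI T * U = U * resolventI T := by
  have h : (T + algebraMap ℂ (H →L[ℂ] H) Complex.I) * U =
      U * (T + algebraMap ℂ (H →L[ℂ] H) Complex.I) := by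
    rw [add_mul, mul_add, hTU, Algebra.commutes]
  calc resolventI T * U
      = resolventI T * (U * (T + algebraMap ℂ (H →L[ℂ] H) Complex.I)) * resolventI T := by
        rw [mul_assoc, mul_assoc, add_I_mul_resolventI hT, mul_one]
    _ = _ := by rw [← h, ← mul_assoc, resolventI_mul_add_I hT, one_mul]

theorem resolventI_mem_topologicalClosure {S : StarSubalgebra ℂ (H →L[ℂ] H)} {T : H →L[ℂ] H}
    (hTS : T ∈ S) (hT : star T = T) : resolventI T ∈ S.topologicalClosure := by
  have hmem : T + algebraMap ℂ (H →L[ℂ] H) Complex.I ∈ S.topologicalClosure :=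
    S.le_topologicalClosure (add_mem hTS (S.algebraMap_mem _))
  have : IsClosed (S.topologicalClosure : Set (H →L[ℂ] H)) := S.isClosed_topologicalClosure
  obtain ⟨u, hu⟩ := (StarSubalgebra.coe_isUnit S.topologicalClosure
    (a := ⟨_, hmem⟩)).1 (isUnit_add_I hT)
  have h1 : ((↑u⁻¹ : S.topologicalClosure) : H →L[ℂ] H) *
      (T + algebraMap ℂ (H →L[ℂ] H) Complex.I) = 1 := by
    have := congrArg (Subtype.val) u.inv_mul
    rwa [hu] at this
  rw [← left_inv_eq_right_inv h1 (add_I_mul_resolventI hT)]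
  exact Subtype.property _

end Resolvent

section CountablySeparated

variable {H : Type*} [NormedAddCommGroup H] [InnerProductSpace ℂ H] [CompleteSpace H]

/-- The closed cyclic subspace of a vector under the commutant. -/
noncomputable def cyclicSubspace (M : VonNeumannAlgebra H) (ξ : H) : Submodule ℂ H :=
  (M.commutant.toStarSubalgebra.toSubalgebra.toSubmodule.map
    (ContinuousLinearMap.apply ℂ H ξ).toLinearMap).topologicalClosure

instance (M : VonNeumannAlgebra H) (ξ : H) : CompleteSpace (cyclicSubspace M ξ) :=
  (Submodule.isClosed_topologicalClosure _).completeSpace_coe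

theorem self_mem_cyclicSubspace (M : VonNeumannAlgebra H) (ξ : H) : ξ ∈ cyclicSubspace M ξ :=
  subset_closure ⟨1, one_mem M.commutant, rfl⟩

theorem starProjection_cyclicSubspace_mem (M : VonNeumannAlgebra H) (ξ : H) :
    (cyclicSubspace M ξ).starProjection ∈ M := by
  have hinv : ∀ x ∈ M.commutant, ∀ v ∈ cyclicSubspace M ξ, x v ∈ cyclicSubspace M ξ := by
    intro x hx v hv
    refine map_mem_closure x.continuous hv ?_
    rintro _ ⟨y, hy, rfl⟩
    exact ⟨x * y, mul_mem (S := VonNeumannAlgebra H) hx hy, rfl⟩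
  suffices h : (cyclicSubspace M ξ).starProjection ∈ M.commutant.commutant by
    rwa [M.commutant_commutant] at h
  rw [VonNeumannAlgebra.mem_commutant_iff]
  intro x hx
  ext v
  refine (starProjection_commute_of_invariant (cyclicSubspace M ξ) (T := x) (T' := star x)
    (fun v w => ?_) (hinv x hx) (hinv _ (star_mem hx)) v).symm
  rw [ContinuousLinearMap.star_eq_adjoint, ContinuousLinearMap.adjoint_inner_right]

theorem isOrtho_cyclicSubspace {M : VonNeumannAlgebra H} {ξ η : H}
    (h : ∀ x ∈ M.commutant, inner ℂ (x ξ) η = 0) :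
    cyclicSubspace M ξ ⟂ cyclicSubspace M η := by
  have key : ∀ (K : Submodule ℂ H) (y : H), (∀ x ∈ M.commutant, x y ∈ Kᗮ) →
      cyclicSubspace M y ≤ Kᗮ := by
    intro K y hy
    refine Submodule.topologicalClosure_minimal _ ?_ (Submodule.isClosed_orthogonal _)
    rintro _ ⟨x, hx, rfl⟩
    exact hy x hx
  refine key _ ξ fun x hx => (Submodule.mem_orthogonal' _ _).2 fun w hw => ?_
  have hw' := key (ℂ ∙ x ξ) η (fun y hy => Submodule.mem_orthogonal_singleton_iff_inner_right.2 ?_)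
    hw
  · exact Submodule.mem_orthogonal_singleton_iff_inner_right.1 hw'
  · have h1 := h _ (mul_mem (S := VonNeumannAlgebra H) (star_mem hy) hx)
    rwa [mul_apply_eq_comp, ContinuousLinearMap.star_eq_adjoint,
      ContinuousLinearMap.adjoint_inner_left] at h1

theorem countable_of_pairwise_orthogonal (M : VonNeumannAlgebra H)
    (ψ : (H →L[ℂ] H) →ₗ[ℂ] ℂ) (hpos : ∀ m ∈ M, 0 ≤ ψ (star m * m))
    (hfaith : ∀ m ∈ M, ψ (star m * m) = 0 → m = 0) {s : Set H} (h0 : 0 ∉ s)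
    (hs : ∀ ξ ∈ s, ∀ η ∈ s, ξ ≠ η → ∀ x ∈ M.commutant, inner ℂ (x ξ) η = 0) : s.Countable := by
  let p : s → H →L[ℂ] H := fun ξ => (cyclicSubspace M ξ).starProjection
  have hpM : ∀ ξ, p ξ ∈ M := fun ξ => starProjection_cyclicSubspace_mem M ξ
  have hpstar : ∀ ξ, star (p ξ) = p ξ := fun ξ => isSelfAdjoint_starProjection _
  have hpidem : ∀ ξ, p ξ * p ξ = p ξ := fun ξ => Submodule.isIdempotentElem_starProjection _
  have hport : ∀ ξ η, ξ ≠ η → p ξ * p η = 0 := fun ξ η hne =>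
    (isOrtho_cyclicSubspace (hs ξ ξ.2 η η.2
      (fun h => hne (Subtype.ext h)))).starProjection_comp_starProjection
  have hψp : ∀ ξ, 0 ≤ ψ (p ξ) := fun ξ => by
    have := hpos _ (hpM ξ)
    rwa [hpstar, hpidem] at this
  have hne : ∀ ξ, (ψ (p ξ)).re ≠ 0 := by
    intro ξ hre
    have hz : ψ (p ξ) = 0 := Complex.ext hre (Complex.nonneg_iff.1 (hψp ξ)).2.symm
    have hp0 : p ξ = 0 := hfaith _ (hpM ξ) (by rw [hpstar, hpidem, hz])
    have hξ : p ξ ξ = ξ :=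
      Submodule.starProjection_eq_self_iff.2 (self_mem_cyclicSubspace M ξ)
    rw [hp0] at hξ
    apply h0
    rw [show (0 : H) = ξ from hξ]
    exact ξ.2
  have hsum : ∀ F : Finset s, ∑ ξ ∈ F, (ψ (p ξ)).re ≤ (ψ 1).re := by
    intro F
    set q : H →L[ℂ] H := ∑ ξ ∈ F, p ξ with hq
    have hqM : q ∈ M := sum_mem fun ξ _ => hpM ξ
    have hqs : star q = q := by simp only [hq, star_sum, hpstar]
    have hqq : q * q = q := by
      classical
      rw [hq, Finset.sum_mul_sum]
      refine Finset.sum_congr rfl fun ξ hξ => ?_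
      rw [Finset.sum_eq_single ξ (fun η _ hne => hport ξ η hne.symm) (fun h => (h hξ).elim), hpidem]
    have h1 := hpos _ (sub_mem (one_mem M) hqM)
    have h2 : star (1 - q) * (1 - q) = 1 - q := by
      rw [star_sub, star_one, hqs, mul_sub, sub_mul, sub_mul, hqq]; simp
    rw [h2, map_sub, hq, map_sum] at h1
    have h3 := (Complex.nonneg_iff.1 h1).1
    rw [Complex.sub_re, Complex.re_sum] at h3
    linarith
  have hcount := (summable_of_sum_le (fun ξ => (Complex.nonneg_iff.1 (hψp ξ)).1)
    hsum).countable_support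
  have huniv : Function.support (fun ξ : s => (ψ (p ξ)).re) = Set.univ :=
    Set.eq_univ_of_forall hne
  rw [huniv, Set.countable_univ_iff] at hcount
  exact hcount

/-- A von Neumann algebra with a faithful positive functional has a countable separating
family of vectors. -/
theorem exists_seq_cyclic_commutant (M : VonNeumannAlgebra H)
    (ψ : (H →L[ℂ] H) →ₗ[ℂ] ℂ) (hpos : ∀ m ∈ M, 0 ≤ ψ (star m * m))
    (hfaith : ∀ m ∈ M, ψ (star m * m) = 0 → m = 0) :
    ∃ ζ : ℕ → H, ∀ η, (∀ j, ∀ x ∈ M.commutant, inner ℂ (x (ζ j)) η = 0) → η = 0 := by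
  obtain ⟨s, ⟨h0, hs⟩, hmax⟩ := zorn_subset
    {s : Set H | 0 ∉ s ∧ ∀ ξ ∈ s, ∀ η ∈ s, ξ ≠ η → ∀ x ∈ M.commutant, inner ℂ (x ξ) η = 0} (by
      intro c hc hchain
      refine ⟨⋃₀ c, ⟨?_, ?_⟩, fun s hs => Set.subset_sUnion_of_mem hs⟩
      · rintro ⟨t, ht, h0⟩
        exact (hc ht).1 h0
      · rintro ξ ⟨t, ht, hξ⟩ η ⟨u, hu, hη⟩
        rcases hchain.total ht hu with h | h
        · exact (hc hu).2 ξ (h hξ) η hη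
        · exact (hc ht).2 ξ hξ η (h hη))
  obtain ⟨ζ, hζ⟩ := ((countable_of_pairwise_orthogonal M ψ hpos hfaith h0 hs).insert
    (0 : H)).exists_eq_range (Set.insert_nonempty _ _)
  refine ⟨ζ, fun η hη => ?_⟩
  have hη' : ∀ ξ ∈ s, ∀ x ∈ M.commutant, inner ℂ (x ξ) η = 0 := by
    intro ξ hξ x hx
    have hmem : ξ ∈ Set.range ζ := hζ ▸ Set.mem_insert_of_mem _ hξ
    obtain ⟨j, rfl⟩ := hmem
    exact hη j x hx
  by_contra hne
  have hins : η ∈ s := by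
    refine hmax ⟨?_, ?_⟩ (Set.subset_insert η s) (Set.mem_insert _ _)
    · rintro (h | h)
      · exact hne h.symm
      · exact h0 h
    · rintro ξ (rfl | hξ) θ (rfl | hθ) hξθ x hx
      · exact (hξθ rfl).elim
      · rw [← ContinuousLinearMap.adjoint_inner_right, ← inner_conj_symm,
          ← ContinuousLinearMap.star_eq_adjoint, hη' θ hθ _ (star_mem hx), map_zero]
      · exact hη' ξ hξ x hx
      · exact hs ξ hξ θ hθ hξθ x hx
  exact hne (inner_self_eq_zero.1 (hη' η hins 1 (one_mem _)))

end CountablySeparated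

section SequentialDensity

variable {H : Type*} [NormedAddCommGroup H] [InnerProductSpace ℂ H] [CompleteSpace H]

/-- Contractive sequences which converge on the orbits of a separating family under the commutant
converge strongly. -/
theorem tendsto_of_tendsto_separating {M : VonNeumannAlgebra H} {ζ : ℕ → H}
    (hζ : ∀ η, (∀ j, ∀ x ∈ M.commutant, inner ℂ (x (ζ j)) η = 0) → η = 0)
    {R : ℕ → H →L[ℂ] H} {w : H →L[ℂ] H} (hR : ∀ n ξ, ‖R n ξ‖ ≤ ‖ξ‖) (hw : ∀ ξ, ‖w ξ‖ ≤ ‖ξ‖)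
    (h : ∀ j, ∀ x ∈ M.commutant, Tendsto (fun n => R n (x (ζ j))) atTop (𝓝 (w (x (ζ j)))))
    (ξ : H) : Tendsto (fun n => R n ξ) atTop (𝓝 (w ξ)) := by
  let V : Submodule ℂ H :=
    { carrier := {ξ | Tendsto (fun n => R n ξ) atTop (𝓝 (w ξ))}
      zero_mem' := by simp
      add_mem' := fun {a b} ha hb => by simpa using Tendsto.add ha hb
      smul_mem' := fun c a ha => by simpa using Tendsto.const_smul ha c }
  have hV : IsClosed (V : Set H) := by
    refine isClosed_of_closure_subset fun a ha => ?_
    refine Metric.tendsto_atTop.2 fun ε hε => ?_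
    obtain ⟨b, hb, hab⟩ := Metric.mem_closure_iff.1 ha (ε / 3) (by positivity)
    obtain ⟨N, hN⟩ := Metric.tendsto_atTop.1 hb (ε / 3) (by positivity)
    refine ⟨N, fun n hn => ?_⟩
    have h1 := hN n hn
    have h2 := hR n (a - b)
    have h3 := hw (b - a)
    rw [map_sub] at h2 h3
    rw [dist_eq_norm] at hab h1 ⊢
    rw [norm_sub_rev b a] at h3
    calc ‖R n a - w a‖ = ‖(R n a - R n b) + (R n b - w b) + (w b - w a)‖ := by congr 1; abel
      _ ≤ ‖R n a - R n b‖ + ‖R n b - w b‖ + ‖w b - w a‖ := norm_add₃_le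
      _ < ε := by linarith
  have hVbot : Vᗮ = ⊥ := by
    rw [eq_bot_iff]
    intro η hη
    exact hζ η fun j x hx => (Submodule.mem_orthogonal _ _).1 hη _ (h j x hx)
  have : CompleteSpace V := hV.completeSpace_coe
  rw [Submodule.orthogonal_eq_bot_iff] at hVbot
  have hmem : ξ ∈ V := hVbot ▸ Submodule.mem_top
  exact hmem

theorem resolventI_mem_strongSpan {M : VonNeumannAlgebra H} {ζ : ℕ → H}
    (hζ : ∀ η, (∀ j, ∀ x ∈ M.commutant, inner ℂ (x (ζ j)) η = 0) → η = 0)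
    {S : StarSubalgebra ℂ (H →L[ℂ] H)} (hSM : (S : Set (H →L[ℂ] H)) ⊆ M) {h : H →L[ℂ] H}
    (hh : h ∈ Set.centralizer (Set.centralizer (S : Set (H →L[ℂ] H)))) (hhM : h ∈ M)
    (hsa : star h = h) : resolventI h ∈ strongSpan (S : Set (H →L[ℂ] H)) := by
  obtain ⟨k, hk, hlim⟩ := exists_seq_isSelfAdjoint_tendsto S hh hsa fun j => resolventI h (ζ j)
  refine isSeqStrongClosed_strongSpan _ (fun n => resolventI (k n)) _ (fun n => ?_) ?_
  · exact (isSeqStrongClosed_strongSpan _).closure_subset (subset_strongSpan _)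
      (resolventI_mem_topologicalClosure (hk n).1 (hk n).2)
  refine tendsto_of_tendsto_separating hζ (fun n => norm_resolventI_apply_le (hk n).2)
    (norm_resolventI_apply_le hsa) fun j x hx => ?_
  have hbase : Tendsto (fun n => resolventI (k n) (ζ j)) atTop (𝓝 (resolventI h (ζ j))) := by
    rw [tendsto_iff_norm_sub_tendsto_zero]
    have hz := tendsto_iff_norm_sub_tendsto_zero.1 (hlim j)
    refine squeeze_zero (fun _ => norm_nonneg _) (fun n => ?_) hz
    have h1 := congrArg (fun T : H →L[ℂ] H => T (ζ j)) (resolventI_sub_resolventI (hk n).2 hsa)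
    calc ‖resolventI (k n) (ζ j) - resolventI h (ζ j)‖
        = ‖resolventI (k n) ((h - k n) (resolventI h (ζ j)))‖ := congrArg norm h1
      _ ≤ ‖(h - k n) (resolventI h (ζ j))‖ := norm_resolventI_apply_le (hk n).2 _
      _ = _ := by rw [norm_sub_rev]; rfl
  have hcomm : ∀ T ∈ M, star T = T → resolventI T (x (ζ j)) = x (resolventI T (ζ j)) :=
    fun T hT hTs => congrArg (fun U : H →L[ℂ] H => U (ζ j))
      (resolventI_mul_comm hTs (VonNeumannAlgebra.mem_commutant_iff.1 hx T hT))
  rw [hcomm h hhM hsa]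
  exact ((x.continuous.tendsto _).comp hbase).congr fun n => (hcomm _ (hSM (hk n).1) (hk n).2).symm

theorem IsSeqStrongClosed.mem_of_resolventI_mem {V : Submodule ℂ (H →L[ℂ] H)}
    (hV : IsSeqStrongClosed V) (h1 : (1 : H →L[ℂ] H) ∈ V) {h : H →L[ℂ] H} (hsa : star h = h)
    (hres : ∀ t : ℝ, resolventI ((t : ℂ) • h) ∈ V) : h ∈ V := by
  have hstar : ∀ t : ℝ, star ((t : ℂ) • h) = (t : ℂ) • h := fun t => by
    rw [star_smul, hsa]; simp
  have hmul : ∀ t : ℝ, t ≠ 0 → h * resolventI ((t : ℂ) • h) ∈ V := by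
    intro t ht
    have h2 := add_I_mul_resolventI (hstar t)
    rw [add_mul, Algebra.algebraMap_eq_smul_one, smul_mul_assoc, smul_mul_assoc, one_mul] at h2
    have h3 : h * resolventI ((t : ℂ) • h) =
        (t : ℂ)⁻¹ • (1 - Complex.I • resolventI ((t : ℂ) • h)) := by
      rw [← h2, add_sub_cancel_right, smul_smul, inv_mul_cancel₀ (by exact_mod_cast ht), one_smul]
    rw [h3]
    exact V.smul_mem _ (V.sub_mem h1 (V.smul_mem _ (hres t)))
  have hcont : ContinuousAt (fun t : ℝ => h * resolventI ((t : ℂ) • h)) 0 := by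
    refine continuousAt_const.mul ?_
    have hu := NormedRing.inverse_continuousAt (isUnit_add_I (hstar 0)).unit
    refine ContinuousAt.comp (f := fun t : ℝ => (t : ℂ) • h + algebraMap ℂ (H →L[ℂ] H) Complex.I)
      (g := Ring.inverse) hu ?_
    fun_prop
  have hseq := hcont.tendsto.comp
    (tendsto_one_div_add_atTop_nhds_zero_nat (𝕜 := ℝ))
  have hlim := hV.mem_of_tendsto (fun n => hmul _ (Nat.one_div_pos_of_nat (n := n)).ne') hseq
  have h0 : Complex.I • resolventI (((0 : ℝ) : ℂ) • h) = 1 := by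
    have h2 := add_I_mul_resolventI (hstar 0)
    rw [Complex.ofReal_zero, zero_smul] at h2 ⊢
    rwa [zero_add, Algebra.algebraMap_eq_smul_one, smul_mul_assoc, one_mul] at h2
  have h4 := V.smul_mem Complex.I hlim
  rwa [← mul_smul_comm, h0, mul_one] at h4

/-- In a von Neumann algebra carrying a faithful positive functional, the double commutant of a
star subalgebra is contained in its strong sequential closure. -/
theorem bicommutant_subset_strongSpan (M : VonNeumannAlgebra H)
    (ψ : (H →L[ℂ] H) →ₗ[ℂ] ℂ) (hpos : ∀ m ∈ M, 0 ≤ ψ (star m * m))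
    (hfaith : ∀ m ∈ M, ψ (star m * m) = 0 → m = 0)
    {S : StarSubalgebra ℂ (H →L[ℂ] H)} (hSM : (S : Set (H →L[ℂ] H)) ⊆ M) :
    Set.centralizer (Set.centralizer (S : Set (H →L[ℂ] H))) ⊆
      strongSpan (S : Set (H →L[ℂ] H)) := by
  obtain ⟨ζ, hζ⟩ := exists_seq_cyclic_commutant M ψ hpos hfaith
  let L : StarSubalgebra ℂ (H →L[ℂ] H) :=
    (StarSubalgebra.centralizer ℂ (StarSubalgebra.centralizer ℂ (S : Set (H →L[ℂ] H)) :
      Set (H →L[ℂ] H)))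
  have hL : ∀ x, x ∈ L ↔ x ∈ Set.centralizer (Set.centralizer (S : Set (H →L[ℂ] H))) := by
    intro x
    have hstar : ∀ T : StarSubalgebra ℂ (H →L[ℂ] H),
        (StarSubalgebra.centralizer ℂ (T : Set (H →L[ℂ] H)) : Set (H →L[ℂ] H)) =
          Set.centralizer (T : Set (H →L[ℂ] H)) := by
      intro T
      rw [StarSubalgebra.coe_centralizer]
      simp
    rw [← SetLike.mem_coe, hstar, hstar]
  have hLM : ∀ x ∈ L, x ∈ M := by
    intro x hx
    rw [← SetLike.mem_coe, ← M.centralizer_centralizer]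
    exact Set.centralizer_subset (Set.centralizer_subset hSM) ((hL x).1 hx)
  have hsa : ∀ x ∈ L, star x = x → x ∈ strongSpan (S : Set (H →L[ℂ] H)) := by
    intro x hx hxs
    refine (isSeqStrongClosed_strongSpan _).mem_of_resolventI_mem
      (subset_strongSpan _ (one_mem S)) hxs fun t => ?_
    have hmem := L.smul_mem hx (t : ℂ)
    exact resolventI_mem_strongSpan hζ hSM ((hL _).1 hmem) (hLM _ hmem)
      (by rw [star_smul, hxs]; simp)
  intro x hx
  have hxL := (hL x).2 hx
  have h1 := hsa (x + star x) (add_mem hxL (star_mem hxL)) (by simp [add_comm])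
  have h2 := hsa (Complex.I • (x - star x)) (L.smul_mem (sub_mem hxL (star_mem hxL)) _)
    (by rw [star_smul, star_sub, star_star]; simp [← smul_neg])
  have h3 : x = (2 : ℂ)⁻¹ • ((x + star x) - Complex.I • (Complex.I • (x - star x))) := by
    rw [smul_smul, Complex.I_mul_I]
    module
  rw [h3]
  exact Submodule.smul_mem _ _ (Submodule.sub_mem _ h1 (Submodule.smul_mem _ _ h2))

end SequentialDensity

section AlternatingWords

variable {R : Type*} [Ring R]

/-- Alternating products of elements of `P` and `Q`; the index tells whether the first factor
lies in `P`. -/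
inductive AltWord (P Q : Set R) : Bool → R → Prop
  | single (c : Bool) (y : R) (hy : y ∈ bif c then P else Q) : AltWord P Q c y
  | cons (c : Bool) (y z : R) (hy : y ∈ bif c then P else Q) (hz : AltWord P Q (!c) z) :
      AltWord P Q c (y * z)

/-- Alternating products of elements of `P` and `Q` whose first and last factors lie in `Q`. -/
inductive SandwichWord (P Q : Set R) : R → Prop
  | single (b : R) (hb : b ∈ Q) : SandwichWord P Q b
  | cons (b d w : R) (hb : b ∈ Q) (hd : d ∈ P) (hw : SandwichWord P Q w) :
      SandwichWord P Q (b * d * w)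

theorem AltWord.exists_ofFn {P Q : Set R} {c : Bool} {z : R} (h : AltWord P Q c z) :
    ∃ (n : ℕ) (y : Fin (n + 1) → R) (k : Fin (n + 1) → Bool),
      (∀ i, (k i = true → y i ∈ P) ∧ (k i = false → y i ∈ Q)) ∧
      (∀ i : Fin n, k i.castSucc ≠ k i.succ) ∧ k 0 = c ∧ (List.ofFn y).prod = z := by
  have hmem : ∀ {c : Bool} {y : R}, y ∈ (bif c then P else Q) →
      (c = true → y ∈ P) ∧ (c = false → y ∈ Q) := by
    intro c y hy
    cases c <;> simpa using hy
  induction h with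
  | single c y hy =>
    exact ⟨0, fun _ => y, fun _ => c, fun _ => hmem hy, fun i => i.elim0, rfl, by simp⟩
  | cons c y z hy _ ih =>
    obtain ⟨n, u, k, hu, hk, hk0, rfl⟩ := ih
    refine ⟨n + 1, Fin.cons y u, Fin.cons c k, ?_, ?_, rfl, by simp [List.ofFn_succ]⟩
    · intro i
      refine Fin.cases ?_ (fun j => ?_) i
      · simpa using hmem hy
      · simpa using hu j
    · intro i
      refine Fin.cases ?_ (fun j => ?_) i
      · simp [hk0]
      · rw [← Fin.succ_castSucc, Fin.cons_succ, Fin.cons_succ]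
        exact hk j

theorem FreeOn.eq_zero_of_altWord {φ : R → ℂ} {P Q : Set R} (hφ : FreeOn φ P Q) {c : Bool} {z : R}
    (h : AltWord P Q c z) : φ z = 0 := by
  obtain ⟨n, y, k, hy, hk, -, rfl⟩ := h.exists_ofFn
  exact hφ n y k hy hk

namespace SandwichWord

variable {P Q : Set R} {w w' d : R}

theorem mono {P' : Set R} (hP : P ⊆ P') (h : SandwichWord P Q w) : SandwichWord P' Q w := by
  induction h with
  | single b hb => exact single b hb
  | cons b d w hb hd _ ih => exact cons b d w hb (hP hd) ih

theorem append (h : SandwichWord P Q w) (hd : d ∈ P) (h' : SandwichWord P Q w') :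
    SandwichWord P Q (w * d * w') := by
  induction h with
  | single b hb => exact cons b d w' hb hd h'
  | cons b a w hb ha _ ih =>
    have := cons b a _ hb ha ih
    rwa [show b * a * (w * d * w') = b * a * w * d * w' by simp only [mul_assoc]] at this

theorem altWord (h : SandwichWord P Q w) : AltWord P Q false w := by
  induction h with
  | single b hb => exact .single false b hb
  | cons b d w hb hd _ ih =>
    rw [mul_assoc]
    exact .cons false b _ hb (.cons true d w hd ih)

theorem altWord_mul_right (h : SandwichWord P Q w) (hd : d ∈ P) : AltWord P Q false (w * d) := by
  induction h with
  | single b hb => exact .cons false b _ hb (.single true d hd)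
  | cons b a w hb ha _ ih =>
    rw [mul_assoc, mul_assoc]
    exact .cons false b _ hb (.cons true a _ ha ih)

end SandwichWord

variable [Algebra ℂ R]

theorem SandwichWord.mem_subalgebra {P Q : Set R} {w : R} {𝒮 : Subalgebra ℂ R}
    (hP : P ⊆ 𝒮) (hQ : Q ⊆ 𝒮) (h : SandwichWord P Q w) : w ∈ 𝒮 := by
  induction h with
  | single b hb => exact hQ hb
  | cons b d w hb hd _ ih => exact mul_mem (mul_mem (hQ hb) (hP hd)) ih

/-- The kernel of `φ` in the subalgebra `𝒟`. -/
def centeredPart (φ : R →ₗ[ℂ] ℂ) (𝒟 : Subalgebra ℂ R) : Set R := {m | m ∈ 𝒟 ∧ φ m = 0}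

theorem exists_eq_smul_one_add_centered {φ : R →ₗ[ℂ] ℂ} (hφ : φ 1 = 1) {𝒟 : Subalgebra ℂ R} {d : R}
    (hd : d ∈ 𝒟) : ∃ (c : ℂ) (d₀ : R), d₀ ∈ centeredPart φ 𝒟 ∧ d = c • 1 + d₀ :=
  ⟨φ d, d - φ d • 1, ⟨sub_mem hd (𝒟.smul_mem (one_mem _) _), by simp [hφ]⟩, by simp⟩

theorem map_sandwich_eq_zero {φ : R →ₗ[ℂ] ℂ} (hφ : φ 1 = 1) {𝒟 : Subalgebra ℂ R} {Q : Set R}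
    (hfree : FreeOn φ (centeredPart φ 𝒟) Q) {w d d' : R}
    (hw : SandwichWord (centeredPart φ 𝒟) Q w) (hd : d ∈ 𝒟) (hd' : d' ∈ 𝒟) :
    φ (d * w * d') = 0 := by
  obtain ⟨c, a, ha, rfl⟩ := exists_eq_smul_one_add_centered hφ hd
  obtain ⟨c', a', ha', rfl⟩ := exists_eq_smul_one_add_centered hφ hd'
  have h1 := hfree.eq_zero_of_altWord hw.altWord
  have h2 := hfree.eq_zero_of_altWord (hw.altWord_mul_right ha')
  have h3 : φ (a * w) = 0 := hfree.eq_zero_of_altWord (.cons true a w ha hw.altWord)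
  have h4 : φ (a * (w * a')) = 0 :=
    hfree.eq_zero_of_altWord (.cons true a _ ha (hw.altWord_mul_right ha'))
  simp only [add_mul, mul_add, smul_mul_assoc, mul_smul_comm, one_mul, mul_one, map_add, map_smul,
    mul_assoc, h1, h2, h3, h4, smul_zero, add_zero]

/-- The algebra generated by `𝒜` and `ℬ` is spanned by `𝒜` and the products `a * w * a'` with
`a, a' ∈ 𝒜` and `w` an alternating centered word beginning and ending in `ℬ`. -/
theorem adjoin_union_le_span_sandwich {φ : R →ₗ[ℂ] ℂ} (hφ : φ 1 = 1) (𝒜 ℬ : Subalgebra ℂ R) :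
    ((Algebra.adjoin ℂ ((𝒜 : Set R) ∪ ℬ) : Subalgebra ℂ R) : Set R) ⊆
      Submodule.span ℂ ((𝒜 : Set R) ∪ {x | ∃ a ∈ 𝒜, ∃ a' ∈ 𝒜, ∃ w,
        SandwichWord (centeredPart φ 𝒜) (centeredPart φ ℬ) w ∧ x = a * w * a'}) := by
  set T := Submodule.span ℂ ((𝒜 : Set R) ∪ {x | ∃ a ∈ 𝒜, ∃ a' ∈ 𝒜, ∃ w,
    SandwichWord (centeredPart φ 𝒜) (centeredPart φ ℬ) w ∧ x = a * w * a'}) with hT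
  have hA : ∀ a ∈ 𝒜, a ∈ T := fun a ha => Submodule.subset_span (.inl ha)
  have hW : ∀ a ∈ 𝒜, ∀ a' ∈ 𝒜, ∀ w, SandwichWord (centeredPart φ 𝒜) (centeredPart φ ℬ) w →
      a * w * a' ∈ T := fun a ha a' ha' w hw =>
    Submodule.subset_span (.inr ⟨a, ha, a', ha', w, hw, rfl⟩)
  have hW1 : ∀ a' ∈ 𝒜, ∀ w, SandwichWord (centeredPart φ 𝒜) (centeredPart φ ℬ) w →
      w * a' ∈ T := fun a' ha' w hw => by simpa using hW 1 (one_mem _) a' ha' w hw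
  have hmulA : ∀ a ∈ 𝒜, ∀ t ∈ T, a * t ∈ T := by
    intro a ha t ht
    refine (Submodule.span_le (p := T.comap (LinearMap.mulLeft ℂ a))).2 ?_ ht
    rintro x (hx | ⟨a₁, ha₁, a', ha', w, hw, rfl⟩)
    · exact hA _ (mul_mem ha hx)
    · change a * (a₁ * w * a') ∈ T
      rw [show a * (a₁ * w * a') = a * a₁ * w * a' by simp only [mul_assoc]]
      exact hW _ (mul_mem ha ha₁) _ ha' w hw
  have hmulBw : ∀ b ∈ ℬ, ∀ a' ∈ 𝒜, ∀ w, SandwichWord (centeredPart φ 𝒜) (centeredPart φ ℬ) w →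
      b * (w * a') ∈ T := by
    intro b hb a' ha' w hw
    cases hw with
    | single b₁ hb₁ =>
      obtain ⟨μ, b₀, hb₀, heq⟩ := exists_eq_smul_one_add_centered hφ (mul_mem hb hb₁.1)
      rw [← mul_assoc, heq, add_mul, smul_mul_assoc, one_mul]
      exact T.add_mem (T.smul_mem _ (hA _ ha')) (hW1 _ ha' _ (.single b₀ hb₀))
    | cons b₁ d w hb₁ hd hw =>
      obtain ⟨μ, b₀, hb₀, heq⟩ := exists_eq_smul_one_add_centered hφ (mul_mem hb hb₁.1)
      rw [show b * (b₁ * d * w * a') = b * b₁ * (d * w * a') by simp only [mul_assoc], heq, add_mul,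
        smul_mul_assoc, one_mul]
      refine T.add_mem (T.smul_mem _ (hW _ hd.1 _ ha' _ hw)) ?_
      have := hW1 _ ha' _ (.cons b₀ d w hb₀ hd hw)
      rwa [show b₀ * d * w * a' = b₀ * (d * w * a') by simp only [mul_assoc]] at this
  have hmulB : ∀ b ∈ ℬ, ∀ t ∈ T, b * t ∈ T := by
    intro b hb t ht
    obtain ⟨μ, b₀, hb₀, rfl⟩ := exists_eq_smul_one_add_centered hφ hb
    refine (Submodule.span_le (p := T.comap (LinearMap.mulLeft ℂ (μ • 1 + b₀)))).2 ?_ ht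
    rintro x (hx | ⟨a, ha, a', ha', w, hw, rfl⟩)
    · change (μ • 1 + b₀) * x ∈ T
      rw [add_mul, smul_mul_assoc, one_mul]
      exact T.add_mem (T.smul_mem _ (hA _ hx)) (hW1 _ hx _ (.single b₀ hb₀))
    · change (μ • 1 + b₀) * (a * w * a') ∈ T
      obtain ⟨ν, a₀, ha₀, rfl⟩ := exists_eq_smul_one_add_centered hφ ha
      rw [show (μ • 1 + b₀) * ((ν • 1 + a₀) * w * a') = ν • ((μ • 1 + b₀) * (w * a')) +
          (μ • (a₀ * w * a') + b₀ * a₀ * w * a') by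
        simp only [add_mul, mul_add, smul_mul_assoc, mul_smul_comm, one_mul, mul_assoc, smul_add]]
      exact T.add_mem (T.smul_mem _ (hmulBw _ hb _ ha' w hw)) (T.add_mem
        (T.smul_mem _ (hW _ ha₀.1 _ ha' w hw)) (hW1 _ ha' _ (.cons b₀ a₀ w hb₀ ha₀ hw)))
  have hmul : ∀ x ∈ Algebra.adjoin ℂ ((𝒜 : Set R) ∪ ℬ), ∀ t ∈ T, x * t ∈ T := by
    intro x hx
    induction hx using Algebra.adjoin_induction with
    | mem x hx => exact hx.elim (hmulA x) (hmulB x)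
    | algebraMap r =>
      intro t ht
      rw [← Algebra.smul_def]
      exact T.smul_mem _ ht
    | add x y _ _ ihx ihy =>
      intro t ht
      rw [add_mul]
      exact T.add_mem (ihx t ht) (ihy t ht)
    | mul x y _ _ ihx ihy =>
      intro t ht
      rw [mul_assoc]
      exact ihx _ (ihy t ht)
  intro x hx
  simpa using hmul x hx 1 (hA 1 (one_mem _))

end AlternatingWords

section Corner

variable {H : Type*} [NormedAddCommGroup H] [InnerProductSpace ℂ H]

/-- The elements `a * w * b` of the corner, with `w` a centered alternating word beginning and
ending in the second algebra. -/
def cornerWords (e : H →L[ℂ] H) (𝒜 : Subalgebra ℂ (H →L[ℂ] H)) (P Q : Set (H →L[ℂ] H)) :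
    Set (H →L[ℂ] H) :=
  {x | ∃ a ∈ 𝒜, ∃ b ∈ 𝒜, ∃ w, e * a = a ∧ b * e = b ∧ SandwichWord P Q w ∧ x = a * w * b}

/-- The elements `a * w * d` with `e * a = a`, containing the alternating products which begin in
the compression by `e`. -/
def cornerInitialWords (e : H →L[ℂ] H) (𝒜 𝒟 : Subalgebra ℂ (H →L[ℂ] H)) (P Q : Set (H →L[ℂ] H)) :
    Set (H →L[ℂ] H) :=
  {x | ∃ a ∈ 𝒜, ∃ d ∈ 𝒟, ∃ w, e * a = a ∧ SandwichWord P Q w ∧ x = a * w * d}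

/-- The elements `c * e` and `c * x` with `c` from `Z` and `x` an initial corner word. -/
def cornerFinalWords (e : H →L[ℂ] H) (Z : Set (H →L[ℂ] H)) (X : Set (H →L[ℂ] H)) :
    Set (H →L[ℂ] H) :=
  {x | ∃ c ∈ Z, x = c * e ∨ ∃ y ∈ X, x = c * y}

/-- A functional continuous along bounded strongly convergent sequences vanishes on the strong
span of any set on which it vanishes. -/
theorem eq_zero_of_mem_strongSpan [CompleteSpace H] (M : VonNeumannAlgebra H)
    {ψ : (H →L[ℂ] H) →ₗ[ℂ] ℂ}
    (hψ : ∀ (w : H →L[ℂ] H) (R : ℕ → H →L[ℂ] H), w ∈ M → (∀ k, R k ∈ M) →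
      (∀ ξ : H, Tendsto (fun k => R k ξ) atTop (𝓝 (w ξ))) →
      Tendsto (fun k => ψ (R k)) atTop (𝓝 (ψ w)))
    {S : Set (H →L[ℂ] H)} (hSM : S ⊆ M) (hS : ∀ x ∈ S, ψ x = 0) {x : H →L[ℂ] H}
    (hx : x ∈ strongSpan S) : ψ x = 0 := by
  have hV : IsSeqStrongClosed (M.toStarSubalgebra.toSubalgebra.toSubmodule ⊓ LinearMap.ker ψ) := by
    intro R w hR hw
    have hwM := isSeqStrongClosed_vonNeumannAlgebra M R w (fun k => (hR k).1) hw
    refine ⟨hwM, ?_⟩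
    refine tendsto_nhds_unique (hψ w R hwM (fun k => (hR k).1) hw) ?_
    have h0 : ∀ k, ψ (R k) = 0 := fun k => (hR k).2
    simp only [h0, tendsto_const_nhds]
  exact (strongSpan_le hV (fun y hy => ⟨hSM hy, hS y hy⟩) hx).2

/-- The compression of the strong span of a set `S` by `e`, centered, lies in a strong span
as soon as it does so for `S`. -/
theorem centered_compression_mem_strongSpan [CompleteSpace H] (M : VonNeumannAlgebra H)
    {ψ : (H →L[ℂ] H) →ₗ[ℂ] ℂ}
    (hψ : ∀ (w : H →L[ℂ] H) (R : ℕ → H →L[ℂ] H), w ∈ M → (∀ k, R k ∈ M) →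
      (∀ ξ : H, Tendsto (fun k => R k ξ) atTop (𝓝 (w ξ))) →
      Tendsto (fun k => ψ (R k)) atTop (𝓝 (ψ w)))
    {e : H →L[ℂ] H} (he : e ∈ M) {S U : Set (H →L[ℂ] H)} (hSM : S ⊆ M)
    (hS : ∀ x ∈ S, e * x * e - ((ψ e)⁻¹ * ψ (e * x * e)) • e ∈ strongSpan U) {x : H →L[ℂ] H}
    (hx : x ∈ strongSpan S) : e * x * e - ((ψ e)⁻¹ * ψ (e * x * e)) • e ∈ strongSpan U := by
  let V : Submodule ℂ (H →L[ℂ] H) :=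
    { carrier := {x | x ∈ M ∧ e * x * e - ((ψ e)⁻¹ * ψ (e * x * e)) • e ∈ strongSpan U}
      zero_mem' := ⟨zero_mem M, by simp⟩
      add_mem' := by
        rintro a b ⟨ha, ha'⟩ ⟨hb, hb'⟩
        refine ⟨add_mem ha hb, ?_⟩
        have := add_mem ha' hb'
        rw [mul_add, add_mul, map_add, mul_add, add_smul]
        rwa [sub_add_sub_comm] at this
      smul_mem' := by
        rintro c a ⟨ha, ha'⟩
        refine ⟨M.toStarSubalgebra.smul_mem ha c, ?_⟩
        have := (strongSpan U).smul_mem c ha'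
        rwa [smul_sub, smul_smul, mul_left_comm, ← smul_eq_mul c, ← map_smul, ← smul_mul_assoc,
          ← mul_smul_comm] at this }
  have hV : IsSeqStrongClosed V := by
    intro R w hR hw
    have hwM := isSeqStrongClosed_vonNeumannAlgebra M R w (fun k => (hR k).1) hw
    have hlim : ∀ ξ, Tendsto (fun k => (e * R k * e) ξ) atTop (𝓝 ((e * w * e) ξ)) := fun ξ =>
      (e.continuous.tendsto _).comp (hw (e ξ))
    refine ⟨hwM, isSeqStrongClosed_strongSpan U _ _ (fun k => (hR k).2) fun ξ => ?_⟩
    exact (hlim ξ).sub ((tendsto_const_nhds.mul (hψ _ _ (mul_mem (mul_mem he hwM) he)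
      (fun k => mul_mem (mul_mem he (hR k).1) he) hlim)).smul_const (e ξ))
  exact (strongSpan_le hV (fun y hy => ⟨hSM hy, hS y hy⟩) hx).2

theorem prod_ofFn_mem_of_alternating {R : Type*} [Monoid R] {S T K L : Set R}
    (hSK : S ⊆ K) (hTL : T ⊆ L) (hSL : ∀ x ∈ S, ∀ y ∈ L, x * y ∈ K)
    (hTK : ∀ x ∈ T, ∀ y ∈ K, x * y ∈ L) :
    ∀ (n : ℕ) (y : Fin (n + 1) → R) (c : Fin (n + 1) → Bool),
      (∀ i, (c i = true → y i ∈ S) ∧ (c i = false → y i ∈ T)) →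
      (∀ i : Fin n, c i.castSucc ≠ c i.succ) →
      (List.ofFn y).prod ∈ bif c 0 then K else L := by
  intro n
  induction n with
  | zero =>
    intro y c hy _
    rcases hc : c 0 with _ | _
    · simpa using hTL ((hy 0).2 hc)
    · simpa using hSK ((hy 0).1 hc)
  | succ n ih =>
    intro y c hy hc
    have htail := ih (fun i => y i.succ) (fun i => c i.succ) (fun i => hy i.succ)
      fun i => by simpa using hc i.succ
    have hne : c 0 ≠ c (Fin.succ 0) := by simpa using hc 0
    rw [List.ofFn_succ, List.prod_cons]
    rcases h0 : c 0 with _ | _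
    · have h1 : c (Fin.succ 0) = true := by
        rw [h0] at hne
        simpa using hne.symm
      rw [h1] at htail
      exact hTK _ ((hy 0).2 h0) _ htail
    · have h1 : c (Fin.succ 0) = false := by
        rw [h0] at hne
        simpa using hne.symm
      rw [h1] at htail
      exact hSL _ ((hy 0).1 h0) _ htail

end Corner

/-- Let `𝓜` be a von Neumann algebra with a faithful normal state `ψ`,
let `C, A, B` be unital von Neumann subalgebras of `𝓜` with `C` commuting with `A` and
`ψ(ca) = ψ(c)ψ(a)`, such that `D = W*(C ∪ A)` and `B` are free with respect to `ψ`.  Let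
`e ∈ A` be a minimal projection of the type I factor `A` with `0 < ψ(e) < 1`, and let
`𝓝 = W*(A ∪ B)`.  Then, in the corner `e𝓜e` with the state `ψ_e = ψ(e)⁻¹ψ`, the
subalgebras `e𝓝e` and `Ce` are free with respect to `ψ_e`. -/
theorem corner_of_tensor_free_product_freeness
    {H : Type*} [NormedAddCommGroup H] [InnerProductSpace ℂ H] [CompleteSpace H]
    (𝓜 : VonNeumannAlgebra H)
    (ψ : (H →L[ℂ] H) →ₗ[ℂ] ℂ)
    -- `ψ` is a faithful normal state on `𝓜`
    (hψ1 : ψ 1 = 1)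
    (hψpos : ∀ m ∈ 𝓜, 0 ≤ ψ (star m * m))
    (hψfaith : ∀ m ∈ 𝓜, ψ (star m * m) = 0 → m = 0)
    (hψnormal : ∀ (w : H →L[ℂ] H) (R : ℕ → H →L[ℂ] H) (c : ℝ),
      w ∈ 𝓜 → (∀ k, R k ∈ 𝓜) → (∀ k, ‖R k‖ ≤ c) →
      (∀ ξ : H, Tendsto (fun k => R k ξ) atTop (𝓝 (w ξ))) →
      Tendsto (fun k => ψ (R k)) atTop (𝓝 (ψ w)))
    -- the unital von Neumann subalgebras `C`, `A`, `B` of `𝓜`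
    (C A B : VonNeumannAlgebra H)
    (hC𝓜 : (C : Set (H →L[ℂ] H)) ⊆ 𝓜)
    (hA𝓜 : (A : Set (H →L[ℂ] H)) ⊆ 𝓜)
    (hB𝓜 : (B : Set (H →L[ℂ] H)) ⊆ 𝓜)
    -- `C` commutes with `A`, and `ψ` is multiplicative on products `c·a`
    (hcomm : ∀ c ∈ C, ∀ a ∈ A, c * a = a * c)
    (hmult : ∀ c ∈ C, ∀ a ∈ A, ψ (c * a) = ψ c * ψ a)
    -- `D` is the von Neumann subalgebra generated by `C ∪ A`, free from `B`
    (D : Set (H →L[ℂ] H))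
    (hD : D = Set.centralizer (Set.centralizer
      ((C : Set (H →L[ℂ] H)) ∪ (A : Set (H →L[ℂ] H)))))
    (hfree : FreeOn ψ {m | m ∈ D ∧ ψ m = 0}
      {m | m ∈ B ∧ ψ m = 0})
    -- `e` is a minimal projection of the type I factor `A`, with `0 < ψ(e) < 1`
    (e : H →L[ℂ] H) (heA : e ∈ A) (hestar : star e = e) (heidem : e * e = e)
    (heψ0 : 0 < ψ e) (heψ1 : ψ e < 1)
    (hemin : ∀ x ∈ A, ∃ c : ℂ, e * x * e = c • e)
    -- `𝓝` is the von Neumann subalgebra generated by `A ∪ B`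
    (N : Set (H →L[ℂ] H))
    (hNdef : N = Set.centralizer (Set.centralizer
      ((A : Set (H →L[ℂ] H)) ∪ (B : Set (H →L[ℂ] H)))))
    -- the corner state `ψ_e` on `e𝓜e`
    (ψe : (H →L[ℂ] H) → ℂ) (hψe : ∀ m, ψe m = (ψ e)⁻¹ * ψ m) :
    FreeOn ψe
      {m | (∃ y ∈ N, m = e * y * e) ∧ ψe m = 0}
      {m | (∃ c ∈ C, m = c * e) ∧ ψe m = 0} := by
  have hψe0 : ψ e ≠ 0 := heψ0.ne'
  have hψseq : ∀ (w : H →L[ℂ] H) (R : ℕ → H →L[ℂ] H), w ∈ 𝓜 → (∀ k, R k ∈ 𝓜) →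
      (∀ ξ : H, Tendsto (fun k => R k ξ) atTop (𝓝 (w ξ))) →
      Tendsto (fun k => ψ (R k)) atTop (𝓝 (ψ w)) := by
    intro w R hw hR hlim
    obtain ⟨c, hc⟩ := exists_norm_le_of_strong_tendsto hlim
    exact hψnormal w R c hw hR hc hlim
  have hψe_eq : ∀ m, ψe m = 0 ↔ ψ m = 0 := fun m => by
    rw [hψe, mul_eq_zero, or_iff_right (inv_ne_zero hψe0)]
  -- the algebras involved, as subalgebras of the bounded operators
  let 𝒜 : Subalgebra ℂ (H →L[ℂ] H) := A.toStarSubalgebra.toSubalgebra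
  let ℬ : Subalgebra ℂ (H →L[ℂ] H) := B.toStarSubalgebra.toSubalgebra
  let ℳ : Subalgebra ℂ (H →L[ℂ] H) := 𝓜.toStarSubalgebra.toSubalgebra
  let 𝒟 : Subalgebra ℂ (H →L[ℂ] H) := Subalgebra.centralizer ℂ (Set.centralizer
    ((C : Set (H →L[ℂ] H)) ∪ (A : Set (H →L[ℂ] H))))
  have h𝒟 : ∀ x, x ∈ 𝒟 ↔ x ∈ D := fun x => by rw [hD]; exact Subalgebra.mem_centralizer_iff ℂ
  have hA𝒟 : 𝒜 ≤ 𝒟 := fun a ha => Set.subset_centralizer_centralizer (.inr ha)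
  have hC𝒟 : ∀ c ∈ C, c ∈ 𝒟 := fun c hc => Set.subset_centralizer_centralizer (.inl hc)
  have hM : ∀ s : Set (H →L[ℂ] H), s ⊆ 𝓜 → Set.centralizer (Set.centralizer s) ⊆ 𝓜 := by
    intro s hs
    rw [← 𝓜.centralizer_centralizer]
    exact Set.centralizer_subset (Set.centralizer_subset hs)
  have h𝒟M : 𝒟 ≤ ℳ := hM _ (Set.union_subset hC𝓜 hA𝓜)
  set P := centeredPart ψ 𝒟 with hP
  set Q := centeredPart ψ ℬ with hQ
  have hfree' : FreeOn ψ P Q := by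
    have hPD : P = {m | m ∈ D ∧ ψ m = 0} := by
      ext m
      exact and_congr_left fun _ => h𝒟 m
    rw [hPD]
    exact hfree
  have hPM : P ⊆ ℳ := fun x hx => h𝒟M hx.1
  have hQM : Q ⊆ ℳ := fun x hx => hB𝓜 hx.1
  let SN := cornerWords e 𝒜 P Q
  let SC : Set (H →L[ℂ] H) := {m | (∃ c ∈ C, m = c * e) ∧ ψe m = 0}
  let Z : Set (H →L[ℂ] H) := {c | c ∈ C ∧ ψ c = 0}
  let KN := cornerInitialWords e 𝒜 𝒟 P Q
  let KC := cornerFinalWords e Z KN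
  have hKNM : KN ⊆ 𝓜 := by
    rintro _ ⟨a, ha, d, hd, w, -, hw, rfl⟩
    exact mul_mem (S := Subalgebra ℂ (H →L[ℂ] H)) (s := ℳ)
      (mul_mem (hA𝓜 ha) (hw.mem_subalgebra hPM hQM)) (h𝒟M hd)
  have hKCM : KC ⊆ 𝓜 := by
    rintro _ ⟨c, hc, rfl | ⟨y, hy, rfl⟩⟩
    · exact mul_mem (hC𝓜 hc.1) (hA𝓜 heA)
    · exact mul_mem (hC𝓜 hc.1) (hKNM hy)
  have hKN0 : ∀ x ∈ KN, ψ x = 0 := by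
    rintro _ ⟨a, ha, d, hd, w, -, hw, rfl⟩
    exact map_sandwich_eq_zero hψ1 hfree' hw (hA𝒟 ha) hd
  have hKC0 : ∀ x ∈ KC, ψ x = 0 := by
    rintro _ ⟨c, hc, rfl | ⟨_, ⟨a, ha, d, hd, w, -, hw, rfl⟩, rfl⟩⟩
    · rw [hmult c hc.1 e heA, hc.2, zero_mul]
    · rw [← mul_assoc, ← mul_assoc]
      exact map_sandwich_eq_zero hψ1 hfree' hw (mul_mem (hC𝒟 c hc.1) (hA𝒟 ha)) hd
  have hSC : ∀ x ∈ SC, ∃ c ∈ Z, x = c * e := by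
    rintro _ ⟨⟨c, hc, rfl⟩, h0⟩
    rw [hψe_eq, hmult c hc e heA, mul_eq_zero, or_iff_left hψe0] at h0
    exact ⟨c, ⟨hc, h0⟩, rfl⟩
  have hSNKN : SN ⊆ KN := by
    rintro _ ⟨a, ha, a', ha', w, hea, -, hw, rfl⟩
    exact ⟨a, ha, a', hA𝒟 ha', w, hea, hw, rfl⟩
  have hSCKC : SC ⊆ KC := fun x hx => by
    obtain ⟨c, hc, rfl⟩ := hSC x hx
    exact ⟨c, hc, .inl rfl⟩
  have hSNKC : ∀ x ∈ SN, ∀ y ∈ KC, x * y ∈ KN := by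
    rintro _ ⟨a, ha, a', ha', w, hea, ha'e, hw, rfl⟩ _
      ⟨c, hc, rfl | ⟨_, ⟨a₁, ha₁, d, hd, w₁, -, hw₁, rfl⟩, rfl⟩⟩
    · exact ⟨a, ha, a' * (c * e), mul_mem (hA𝒟 ha') (mul_mem (hC𝒟 c hc.1) (hA𝒟 heA)), w, hea, hw,
        by simp only [mul_assoc]⟩
    · have hmid : a' * c * a₁ ∈ P := by
        refine ⟨mul_mem (mul_mem (hA𝒟 ha') (hC𝒟 c hc.1)) (hA𝒟 ha₁), ?_⟩
        rw [← hcomm c hc.1 a' ha', mul_assoc, hmult c hc.1 _ (mul_mem ha' ha₁), hc.2, zero_mul]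
      exact ⟨a, ha, d, hd, _, hea, hw.append hmid hw₁, by simp only [mul_assoc]⟩
  have hSCKN : ∀ x ∈ SC, ∀ y ∈ KN, x * y ∈ KC := by
    intro x hx y hy
    obtain ⟨c, hc, rfl⟩ := hSC x hx
    refine ⟨c, hc, .inr ⟨y, hy, ?_⟩⟩
    obtain ⟨a, ha, d, hd, w, hea, hw, rfl⟩ := hy
    rw [mul_assoc c, ← mul_assoc e, ← mul_assoc e, hea]
  -- the centered part of the corner of `N` is strongly spanned by the corner words
  have hN : {m | (∃ y ∈ N, m = e * y * e) ∧ ψe m = 0} ⊆ strongSpan SN := by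
    rintro _ ⟨⟨y, hy, rfl⟩, h0⟩
    rw [hψe_eq] at h0
    let 𝒮 : StarSubalgebra ℂ (H →L[ℂ] H) :=
      StarAlgebra.adjoin ℂ ((A : Set (H →L[ℂ] H)) ∪ (B : Set (H →L[ℂ] H)))
    have h𝒮 : (𝒮 : Set (H →L[ℂ] H)) =
        (Algebra.adjoin ℂ ((𝒜 : Set (H →L[ℂ] H)) ∪ ℬ) : Subalgebra ℂ (H →L[ℂ] H)) := by
      have hstar : star ((A : Set (H →L[ℂ] H)) ∪ (B : Set (H →L[ℂ] H))) ⊆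
          (A : Set (H →L[ℂ] H)) ∪ (B : Set (H →L[ℂ] H)) := by
        rintro x (hx | hx)
        · exact .inl (by simpa using star_mem (s := A) hx)
        · exact .inr (by simpa using star_mem (s := B) hx)
      have h1 := congrArg (fun T : Subalgebra ℂ (H →L[ℂ] H) => (T : Set (H →L[ℂ] H)))
        (StarAlgebra.adjoin_toSubalgebra ℂ ((A : Set (H →L[ℂ] H)) ∪ (B : Set (H →L[ℂ] H))))
      rw [Set.union_eq_self_of_subset_right hstar] at h1
      exact h1
    have h𝒮M : (𝒮 : Set (H →L[ℂ] H)) ⊆ 𝓜 := by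
      rw [h𝒮]
      exact Algebra.adjoin_le (S := ℳ) (Set.union_subset hA𝓜 hB𝓜)
    have hyS : y ∈ Set.centralizer (Set.centralizer (𝒮 : Set (H →L[ℂ] H))) := by
      rw [hNdef] at hy
      exact Set.centralizer_subset
        (Set.centralizer_subset (StarAlgebra.subset_adjoin ℂ _)) hy
    have hy' := bicommutant_subset_strongSpan 𝓜 ψ hψpos hψfaith h𝒮M hyS
    set G : Set (H →L[ℂ] H) := (𝒜 : Set (H →L[ℂ] H)) ∪ {x | ∃ a ∈ 𝒜, ∃ a' ∈ 𝒜, ∃ w,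
      SandwichWord (centeredPart ψ 𝒜) (centeredPart ψ ℬ) w ∧ x = a * w * a'} with hG
    have hAP : centeredPart ψ 𝒜 ⊆ P := fun x hx => ⟨hA𝒟 hx.1, hx.2⟩
    have h𝒮G : (𝒮 : Set (H →L[ℂ] H)) ⊆ strongSpan G := by
      rw [h𝒮]
      exact (adjoin_union_le_span_sandwich hψ1 𝒜 ℬ).trans
        (Submodule.span_le.2 (subset_strongSpan G))
    have hyG : y ∈ strongSpan G := strongSpan_le (isSeqStrongClosed_strongSpan G) h𝒮G hy'
    have hGM : G ⊆ 𝓜 := by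
      rintro x (hx | ⟨a, ha, a', ha', w, hw, rfl⟩)
      · exact hA𝓜 hx
      · exact mul_mem (S := Subalgebra ℂ (H →L[ℂ] H)) (s := ℳ)
          (mul_mem (hA𝓜 ha) ((hw.mono hAP).mem_subalgebra hPM hQM)) (hA𝓜 ha')
    have hfin := centered_compression_mem_strongSpan 𝓜 hψseq (hA𝓜 heA) hGM (U := SN) (by
      rintro x (hx | ⟨a, ha, a', ha', w, hw, rfl⟩)
      · obtain ⟨c, hc⟩ := hemin x hx
        rw [hc, map_smul, smul_eq_mul, mul_left_comm, inv_mul_cancel₀ hψe0, mul_one, sub_self]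
        exact zero_mem _
      · have hmem : e * (a * w * a') * e ∈ SN :=
          ⟨e * a, mul_mem heA ha, a' * e, mul_mem ha' heA, w, by rw [← mul_assoc, heidem],
            by rw [mul_assoc, heidem], hw.mono hAP, by simp only [mul_assoc]⟩
        rw [hKN0 _ (hSNKN hmem), mul_zero, zero_smul, sub_zero]
        exact subset_strongSpan _ hmem) hyG
    rwa [h0, mul_zero, zero_smul, sub_zero] at hfin
  intro n y c hy hc
  rw [hψe_eq]
  have hprod := prod_ofFn_mem_of_alternating (S := (strongSpan SN : Set (H →L[ℂ] H)))
    (T := (strongSpan SC : Set (H →L[ℂ] H))) (K := (strongSpan KN : Set (H →L[ℂ] H)))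
    (L := (strongSpan KC : Set (H →L[ℂ] H)))
    (strongSpan_le (isSeqStrongClosed_strongSpan _) (hSNKN.trans (subset_strongSpan _)))
    (strongSpan_le (isSeqStrongClosed_strongSpan _) (hSCKC.trans (subset_strongSpan _)))
    (fun x hx y hy => mul_mem_strongSpan
      (fun x hx y hy => subset_strongSpan _ (hSNKC x hx y hy)) hx hy)
    (fun x hx y hy => mul_mem_strongSpan
      (fun x hx y hy => subset_strongSpan _ (hSCKN x hx y hy)) hx hy)
    n y c (fun i => ⟨fun h => hN ((hy i).1 h), fun h => subset_strongSpan _ ((hy i).2 h)⟩) hc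
  rcases h0 : c 0 with _ | _ <;> rw [h0] at hprod
  · exact eq_zero_of_mem_strongSpan 𝓜 hψseq hKCM hKC0 hprod
  · exact eq_zero_of_mem_strongSpan 𝓜 hψseq hKNM hKN0 hprod
end

section
/- M and C are free in 𝓜 with respect to ψ; that is, ψ(x_1⋯x_n) = 0 whenever each x_j lies in M ∩ ker ψ or in C ∩ ker ψ and consecutive x_j lie in different ones. -/
open Filter Topology
open scoped ComplexOrder

/-- `Alternating S T a d w`: the element `w` is a nonempty alternating product of elements of `S`
(colour `true`) and of `T` (colour `false`), whose first factor has colour `a` and whose last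
factor has colour `d`. -/
inductive Alternating {A : Type*} [Monoid A] (S T : Set A) : Bool → Bool → A → Prop
  | single (a : Bool) (x : A) (hx : (a = true → x ∈ S) ∧ (a = false → x ∈ T)) :
      Alternating S T a a x
  | snoc (a d e : Bool) (w x : A) (hw : Alternating S T a d w) (hde : d ≠ e)
      (hx : (e = true → x ∈ S) ∧ (e = false → x ∈ T)) : Alternating S T a e (w * x)

namespace Alternating

variable {A : Type*} [Monoid A] {S T : Set A} {a d : Bool} {w : A}

lemma exists_ofFn (h : Alternating S T a d w) :
    ∃ (n : ℕ) (y : Fin (n + 1) → A) (c : Fin (n + 1) → Bool),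
      (∀ i, (c i = true → y i ∈ S) ∧ (c i = false → y i ∈ T)) ∧
      (∀ i : Fin n, c i.castSucc ≠ c i.succ) ∧ c (Fin.last n) = d ∧
      w = (List.ofFn y).prod := by
  induction h with
  | single x hx =>
    exact ⟨0, fun _ => x, fun _ => _, fun _ => hx, fun i => i.elim0, rfl, by simp⟩
  | snoc d e w x _ hde hx ih =>
    obtain ⟨n, y, c, hy, hc, hl, rfl⟩ := ih
    refine ⟨n + 1, Fin.snoc (α := fun _ => A) y x, Fin.snoc (α := fun _ => Bool) c e,
      ?_, ?_, by simp, ?_⟩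
    · intro i
      induction i using Fin.lastCases with
      | last => simpa using hx
      | cast i => simpa using hy i
    · intro i
      induction i using Fin.lastCases with
      | last => simpa [hl] using hde
      | cast i =>
        rw [Fin.succ_castSucc]
        simpa only [Fin.snoc_castSucc] using hc i
    · rw [List.ofFn_succ' (Fin.snoc (α := fun _ => A) y x), List.concat_eq_append]
      simp only [Fin.snoc_castSucc, Fin.snoc_last, List.prod_append, List.prod_singleton]

lemma eq_zero_of_freeOn {R : Type*} [Zero R] {φ : A → R} (hφ : FreeOn φ S T)
    (h : Alternating S T a d w) : φ w = 0 := by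
  obtain ⟨n, y, c, hy, hc, -, rfl⟩ := h.exists_ofFn
  exact hφ n y c hy hc

lemma mem_of_subset {P : Submonoid A} (hS : S ⊆ P) (hT : T ⊆ P)
    (h : Alternating S T a d w) : w ∈ P := by
  have key : ∀ (e : Bool) (x : A), (e = true → x ∈ S) ∧ (e = false → x ∈ T) → x ∈ P := by
    rintro (_ | _) x hx
    · exact hT (hx.2 rfl)
    · exact hS (hx.1 rfl)
  induction h with
  | single x hx => exact key _ x hx
  | snoc d e w x _ _ hx ih => exact P.mul_mem ih (key e x hx)

end Alternating

/-- The words, ending in a letter of colour `d`, obtained from alternating words in `M°`, `C°`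
by splitting every letter from `M°` into its parts in `B°` and in `S = M ∩ ker E`: either the last
letter lies in `S`, or a word in `B₀`, `C₀` follows a letter from `S` or stands alone. -/
def IsSplitWord {A : Type*} [Monoid A] (S T B₀ C₀ : Set A) (d : Bool) (p : A) : Prop :=
  (d = true ∧ ∃ a, Alternating S T a true p) ∨ (∃ a, Alternating B₀ C₀ a d p) ∨
    ∃ a k z, Alternating S T a true k ∧ Alternating B₀ C₀ false d z ∧ p = k * z

namespace IsSplitWord

variable {A : Type*} [Monoid A] {S T B₀ C₀ : Set A} {p x : A}

lemma mul_right (h : IsSplitWord S T B₀ C₀ true p) (hx : x ∈ C₀) :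
    IsSplitWord S T B₀ C₀ false (p * x) := by
  rcases h with ⟨-, a, h⟩ | ⟨a, h⟩ | ⟨a, k, z, hk, hz, rfl⟩
  · exact .inr (.inr ⟨a, p, x, h, .single _ _ (by simpa using hx), rfl⟩)
  · exact .inr (.inl ⟨a, .snoc _ _ _ _ _ h (by simp) (by simpa using hx)⟩)
  · exact .inr (.inr ⟨a, k, z * x, hk, .snoc _ _ _ _ _ hz (by simp) (by simpa using hx),
      mul_assoc _ _ _⟩)

lemma mul_base (h : IsSplitWord S T B₀ C₀ false p) (hx : x ∈ B₀) :
    IsSplitWord S T B₀ C₀ true (p * x) := by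
  rcases h with ⟨h, -⟩ | ⟨a, h⟩ | ⟨a, k, z, hk, hz, rfl⟩
  · cases h
  · exact .inr (.inl ⟨a, .snoc _ _ _ _ _ h (by simp) (by simpa using hx)⟩)
  · exact .inr (.inr ⟨a, k, z * x, hk, .snoc _ _ _ _ _ hz (by simp) (by simpa using hx),
      mul_assoc _ _ _⟩)

lemma mul_left (hT : ∀ a z, Alternating B₀ C₀ a false z → z ∈ T)
    (h : IsSplitWord S T B₀ C₀ false p) (hx : x ∈ S) :
    IsSplitWord S T B₀ C₀ true (p * x) := by
  rcases h with ⟨h, -⟩ | ⟨a, h⟩ | ⟨a, k, z, hk, hz, rfl⟩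
  · cases h
  · exact .inl ⟨rfl, false, .snoc _ false _ _ _ (.single _ _ (by simpa using hT _ _ h)) (by simp)
      (by simpa using hx)⟩
  · exact .inl ⟨rfl, a, .snoc _ false _ _ _ (.snoc _ _ _ _ _ hk (by simp)
      (by simpa using hT _ _ hz)) (by simp) (by simpa using hx)⟩

end IsSplitWord

/-- If every element of `U` is a sum of an element of `B₀` and an element of `S`, and an additive
functional vanishes on all split words, then `U` and `C₀` are free with respect to it. -/
lemma freeOn_of_isSplitWord {A R : Type*} [Ring A] [AddCommGroup R] (φ : A →+ R)
    {S T U B₀ C₀ : Set A}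
    (hT : ∀ a z, Alternating B₀ C₀ a false z → z ∈ T)
    (hU : ∀ m ∈ U, ∃ b ∈ B₀, ∃ s ∈ S, m = b + s)
    (hφ : ∀ d p, IsSplitWord S T B₀ C₀ d p → φ p = 0) :
    FreeOn φ U C₀ := by
  have extend : ∀ (n : ℕ) (y : Fin n → A) (c : Fin n → Bool),
      (∀ i, (c i = true → y i ∈ U) ∧ (c i = false → y i ∈ C₀)) →
      (∀ i j : Fin n, (i : ℕ) + 1 = j → c i ≠ c j) →
      ∀ d p, IsSplitWord S T B₀ C₀ d p → (∀ i : Fin n, (i : ℕ) = 0 → c i ≠ d) →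
      φ (p * (List.ofFn y).prod) = 0 := by
    intro n
    induction n with
    | zero => intro y c _ _ d p hp _; simpa using hφ d p hp
    | succ n ih =>
      intro y c hy hc d p hp h0
      have step : ∀ q, IsSplitWord S T B₀ C₀ (c 0) q →
          φ (q * (List.ofFn fun i => y (Fin.succ i)).prod) = 0 := fun q hq =>
        ih _ (fun i => c i.succ) (fun i => hy _) (fun i j hij => hc _ _ (by simpa using hij)) _ q hq
          (fun i hi => (hc 0 i.succ (by simp [hi])).symm)
      have hd := h0 0 rfl
      rw [List.ofFn_succ, List.prod_cons, ← mul_assoc]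
      cases h : c 0 with
      | false =>
        obtain rfl : d = true := by simpa [h] using hd.symm
        exact step _ (h ▸ hp.mul_right ((hy 0).2 h))
      | true =>
        obtain rfl : d = false := by simpa [h] using hd.symm
        obtain ⟨b, hb, s, hs, hm⟩ := hU _ ((hy 0).1 h)
        rw [hm, mul_add, add_mul, map_add, step _ (h ▸ hp.mul_base hb),
          step _ (h ▸ hp.mul_left hT hs), add_zero]
  intro n y c hy hc
  have tail : ∀ q, IsSplitWord S T B₀ C₀ (c 0) q →
      φ (q * (List.ofFn fun i => y (Fin.succ i)).prod) = 0 := by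
    have hc' : ∀ i j : Fin (n + 1), (i : ℕ) + 1 = j → c i ≠ c j := by
      intro i j hij
      have hj : j = Fin.succ ⟨i, by omega⟩ := Fin.ext hij.symm
      rw [hj]
      exact hc ⟨i, by omega⟩
    exact fun q hq => extend n _ (fun i => c i.succ) (fun i => hy _)
      (fun i j hij => hc' _ _ (by simpa using hij)) _ q hq
      (fun i hi => (hc' 0 i.succ (by simp [hi])).symm)
  rw [List.ofFn_succ, List.prod_cons]
  cases h : c 0 with
  | false =>
    refine tail _ (.inr (.inl ⟨c 0, .single _ _ ?_⟩))
    simpa [h] using (hy 0).2 h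
  | true =>
    obtain ⟨b, hb, s, hs, hm⟩ := hU _ ((hy 0).1 h)
    rw [hm, add_mul, map_add, tail b (.inr (.inl ⟨c 0, .single _ _ (by simpa [h] using hb)⟩)),
      tail s (.inl ⟨h, true, .single _ _ (by simpa using hs)⟩), add_zero]

/-- Let `𝓜` be a von Neumann algebra with a faithful normal state `ψ`,
`B ⊆ 𝓜` a unital von Neumann subalgebra, `G : 𝓜 → B` a normal conditional expectation
with `ψ = (ψ|_B) ∘ G`, and `M`, `C` unital von Neumann subalgebras with `B ⊆ M`.  Let
`A'` be the von Neumann subalgebra generated by `B ∪ C` and `Ω = Λ(B°, C°)` the set of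
alternating products.  If (i) `B` and `C` are free w.r.t. `ψ`, (ii) `G` kills every
element of `Ω` other than `1` and elements of `B°`, and (iii) `M` and `A'` are free with
amalgamation over `B` w.r.t. `G`, then `M` and `C` are free in `𝓜` w.r.t. `ψ`. -/
theorem amalgamated_free_product_freeness
    {H : Type*} [NormedAddCommGroup H] [InnerProductSpace ℂ H] [CompleteSpace H]
    (𝓜 : VonNeumannAlgebra H)
    (ψ : (H →L[ℂ] H) →ₗ[ℂ] ℂ)
    -- `ψ` is a faithful normal state on `𝓜`
    (hψ1 : ψ 1 = 1)
    (hψpos : ∀ m ∈ 𝓜, 0 ≤ ψ (star m * m))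
    (hψfaith : ∀ m ∈ 𝓜, ψ (star m * m) = 0 → m = 0)
    (hψnormal : ∀ (w : H →L[ℂ] H) (R : ℕ → H →L[ℂ] H) (c : ℝ),
      w ∈ 𝓜 → (∀ k, R k ∈ 𝓜) → (∀ k, ‖R k‖ ≤ c) →
      (∀ ξ : H, Tendsto (fun k => R k ξ) atTop (𝓝 (w ξ))) →
      Tendsto (fun k => ψ (R k)) atTop (𝓝 (ψ w)))
    -- the unital von Neumann subalgebras `B ⊆ M` and `C` of `𝓜`
    (B M C : VonNeumannAlgebra H)
    (hB𝓜 : (B : Set (H →L[ℂ] H)) ⊆ 𝓜)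
    (hM𝓜 : (M : Set (H →L[ℂ] H)) ⊆ 𝓜)
    (hC𝓜 : (C : Set (H →L[ℂ] H)) ⊆ 𝓜)
    (hBM : (B : Set (H →L[ℂ] H)) ⊆ (M : Set (H →L[ℂ] H)))
    -- `G : 𝓜 → B` is a normal conditional expectation with `ψ = (ψ|_B) ∘ G`
    (G : (H →L[ℂ] H) →ₗ[ℂ] (H →L[ℂ] H))
    (hG1 : G 1 = 1)
    (hGmem : ∀ x ∈ 𝓜, G x ∈ B)
    (hGB : ∀ b ∈ B, G b = b)
    (hGbim : ∀ b ∈ B, ∀ b' ∈ B, ∀ x ∈ 𝓜, G (b * x * b') = b * G x * b')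
    (hGpos : ∀ x ∈ 𝓜, ∃ y : H →L[ℂ] H, G (star x * x) = star y * y)
    (hGnormal : ∀ (w : H →L[ℂ] H) (R : ℕ → H →L[ℂ] H) (c : ℝ),
      w ∈ 𝓜 → (∀ k, R k ∈ 𝓜) → (∀ k, ‖R k‖ ≤ c) →
      (∀ ξ : H, Tendsto (fun k => R k ξ) atTop (𝓝 (w ξ))) →
      ∀ ξ : H, Tendsto (fun k => G (R k) ξ) atTop (𝓝 (G w ξ)))
    (hψG : ∀ x ∈ 𝓜, ψ (G x) = ψ x)
    -- `A'` is the von Neumann subalgebra generated by `B ∪ C`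
    (A' : Set (H →L[ℂ] H))
    (hA' : A' = Set.centralizer (Set.centralizer
      ((B : Set (H →L[ℂ] H)) ∪ (C : Set (H →L[ℂ] H)))))
    -- `Ω = Λ(B°, C°)`, the alternating products in `B° = B ∩ ker ψ`, `C° = C ∩ ker ψ`
    (Ω : Set (H →L[ℂ] H))
    (hΩ : Ω = {w | w = 1 ∨ ∃ (n : ℕ) (y : Fin (n + 1) → (H →L[ℂ] H))
        (c : Fin (n + 1) → Bool),
      (∀ i, (c i = true → y i ∈ B ∧ ψ (y i) = 0) ∧
        (c i = false → y i ∈ C ∧ ψ (y i) = 0)) ∧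
      (∀ i : Fin n, c i.castSucc ≠ c i.succ) ∧ w = (List.ofFn y).prod})
    -- (i) `B` and `C` are free with respect to `ψ`
    (hBCfree : FreeOn ψ {m | m ∈ B ∧ ψ m = 0} {m | m ∈ C ∧ ψ m = 0})
    -- (ii) `F = G|_{A'}` vanishes on every `z ∈ Ω` other than `1` and elements of `B°`
    (hF0 : ∀ z ∈ Ω, z ≠ 1 → ¬(z ∈ B ∧ ψ z = 0) → G z = 0)
    -- (iii) `M` and `A'` are free with amalgamation over `B` with respect to `G`
    (hamalg : FreeOn (fun m => G m) {m | m ∈ M ∧ G m = 0} {m | m ∈ A' ∧ G m = 0}) :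
    FreeOn ψ {m | m ∈ M ∧ ψ m = 0} {m | m ∈ C ∧ ψ m = 0} := by
  have hBA' : (B : Set (H →L[ℂ] H)) ⊆ A' := fun x hx =>
    hA' ▸ Set.subset_centralizer_centralizer (.inl hx)
  have hCA' : (C : Set (H →L[ℂ] H)) ⊆ A' := fun x hx =>
    hA' ▸ Set.subset_centralizer_centralizer (.inr hx)
  have hA'𝓜 : A' ⊆ 𝓜 := by
    rw [hA', ← 𝓜.centralizer_centralizer]
    exact Set.centralizer_subset (Set.centralizer_subset (Set.union_subset hB𝓜 hC𝓜))
  have one_mem_B : (1 : H →L[ℂ] H) ∈ B := one_mem B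
  set S : Set (H →L[ℂ] H) := {m | m ∈ M ∧ G m = 0} with hS
  set T : Set (H →L[ℂ] H) := {m | m ∈ A' ∧ G m = 0} with hT
  set B₀ : Set (H →L[ℂ] H) := {m | m ∈ B ∧ ψ m = 0} with hB₀
  set C₀ : Set (H →L[ℂ] H) := {m | m ∈ C ∧ ψ m = 0} with hC₀
  have words_mem_𝓜 : ∀ {a d z}, Alternating B₀ C₀ a d z → z ∈ 𝓜 := fun h =>
    h.mem_of_subset (P := 𝓜.toSubmonoid) (fun x hx => hB𝓜 hx.1) (fun x hx => hC𝓜 hx.1)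
  have words_mem_A' : ∀ {a d z}, Alternating B₀ C₀ a d z → z ∈ A' := by
    intro a d z h
    rw [hA'] at hBA' hCA' ⊢
    exact h.mem_of_subset (P := Submonoid.centralizer _)
      (fun x hx => hBA' hx.1) (fun x hx => hCA' hx.1)
  have ST_mem_𝓜 : ∀ {a d z}, Alternating S T a d z → z ∈ 𝓜 := fun h =>
    h.mem_of_subset (P := 𝓜.toSubmonoid) (fun x hx => hM𝓜 hx.1) (fun x hx => hA'𝓜 hx.1)
  have hGT : ∀ a z, Alternating B₀ C₀ a false z → z ∈ T := by
    intro a z hz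
    refine ⟨words_mem_A' hz, ?_⟩
    have hψz : ψ z = 0 := hz.eq_zero_of_freeOn hBCfree
    by_cases hzB : z ∈ B
    · have hstar : star z ∈ B := star_mem hzB
      have hcent : star z - ψ (star z) • (1 : H →L[ℂ] H) ∈ B₀ :=
        ⟨sub_mem hstar (B.toStarSubalgebra.smul_mem one_mem_B _), by simp [hψ1]⟩
      have h0 : ψ (z * (star z - ψ (star z) • (1 : H →L[ℂ] H))) = 0 :=
        (Alternating.snoc _ _ true _ _ hz (by simp) (by simpa using hcent)).eq_zero_of_freeOn
          hBCfree
      have h1 : ψ (star (star z) * star z) = 0 := by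
        simpa [mul_sub, hψz] using h0
      have h2 : z = 0 := star_eq_zero.mp (hψfaith _ (hB𝓜 hstar) h1)
      rw [h2, map_zero]
    · refine hF0 z ?_ ?_ (fun h => hzB h.1)
      · obtain ⟨n, y, c, hy, hc, -, rfl⟩ := hz.exists_ofFn
        rw [hΩ]
        exact .inr ⟨n, y, c, hy, hc, rfl⟩
      · rintro rfl
        exact one_ne_zero (hψ1.symm.trans hψz)
  refine freeOn_of_isSplitWord ψ.toAddMonoidHom (S := S) (T := T) (B₀ := B₀) hGT ?_ ?_
  · rintro m ⟨hm, hψm⟩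
    have hGm := hGmem m (hM𝓜 hm)
    exact ⟨G m, ⟨hGm, by rw [hψG m (hM𝓜 hm), hψm]⟩, m - G m,
      ⟨sub_mem hm (hBM hGm), by rw [map_sub, hGB _ hGm, sub_self]⟩, by simp⟩
  · have vanish : ∀ {a d p}, Alternating S T a d p → ψ p = 0 := fun h => by
      have h0 : G _ = 0 := h.eq_zero_of_freeOn hamalg
      rw [← hψG _ (ST_mem_𝓜 h), h0, map_zero]
    rintro d p (⟨-, a, h⟩ | ⟨a, h⟩ | ⟨a, k, z, hk, hz, rfl⟩)
    · exact vanish h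
    · exact h.eq_zero_of_freeOn hBCfree
    · have block : ∀ w, Alternating B₀ C₀ false false w → Alternating S T a false (k * w) :=
        fun w hw => .snoc _ _ _ _ _ hk (by simp) (by simpa using hGT _ _ hw)
      have hkz : k * z ∈ 𝓜 := mul_mem (ST_mem_𝓜 hk) (words_mem_𝓜 hz)
      change ψ (k * z) = 0
      cases hz with
      | single _ hx => exact vanish (block z (.single _ _ hx))
      | snoc e _ w x hw hde hx =>
        cases d with
        | false => exact vanish (block _ (.snoc _ _ _ _ _ hw hde hx))
        | true =>
          obtain rfl : e = false := by simpa using hde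
          have hkw := block w hw
          have h0 : G (k * w) = 0 := hkw.eq_zero_of_freeOn hamalg
          have h1 := hGbim 1 one_mem_B x (hx.1 rfl).1 (k * w) (ST_mem_𝓜 hkw)
          rw [one_mul, h0, mul_zero, zero_mul, mul_assoc] at h1
          rw [← hψG _ hkz, h1, map_zero]
end

section
/- Let s = s_1 s_2 ⋯ s_m with m ≥ 1, where each factor s_i belongs either to Λ({a},{b}) ∖ {1, a} or to {u, u*}, consecutive factors belong to different ones of these two sets, and at least one factor belongs to {u, u*}. Then ω(s) = 0. -/
open scoped ComplexOrder

/-- The set `Λ({a},{b})` of alternating words in the letters `a` and `b`, including the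
empty word `1`. -/
def altWords {A : Type*} [Monoid A] (a b : A) : Set A :=
  {w | ∃ L : List Bool, L.Chain' (· ≠ ·) ∧
    w = (L.map (fun t => if t then a else b)).prod}

/-- `IsAltProd S T t x`: `x` is a nonempty alternating product of elements of `S` (tagged
`true`) and of `T` (tagged `false`), the first factor having tag `t`. -/
def IsAltProd {A : Type*} [Monoid A] (S T : Set A) (t : Bool) (x : A) : Prop :=
  ∃ (n : ℕ) (y : Fin (n + 1) → A) (c : Fin (n + 1) → Bool),
    (∀ i, (c i = true → y i ∈ S) ∧ (c i = false → y i ∈ T)) ∧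
    (∀ i : Fin n, c i.castSucc ≠ c i.succ) ∧ c 0 = t ∧ x = (List.ofFn y).prod

namespace IsAltProd

variable {A : Type*} [Monoid A] {S T : Set A}

theorem single {t : Bool} {x : A} (h : (t = true → x ∈ S) ∧ (t = false → x ∈ T)) :
    IsAltProd S T t x :=
  ⟨0, fun _ => x, fun _ => t, fun _ => h, fun i => i.elim0, rfl, by simp⟩

theorem cons {t : Bool} {x z : A} (h : (t = true → x ∈ S) ∧ (t = false → x ∈ T))
    (hz : IsAltProd S T (!t) z) : IsAltProd S T t (x * z) := by
  obtain ⟨n, y, c, hy, hc, h0, rfl⟩ := hz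
  refine ⟨n + 1, Fin.cons x y, Fin.cons t c, ?_, ?_, rfl, ?_⟩
  · intro i
    refine Fin.cases ?_ (fun j => ?_) i
    · simpa using h
    · simpa using hy j
  · intro i
    refine Fin.cases ?_ (fun j => ?_) i
    · simp [h0]
    · simpa [← Fin.succ_castSucc] using hc j
  · rw [List.ofFn_cons, List.prod_cons]

theorem left_mul {x z : A} (hx : x ∈ S) (hz : z = 1 ∨ IsAltProd S T false z) :
    IsAltProd S T true (x * z) := by
  rcases hz with rfl | hz
  · simpa using single (S := S) (T := T) (t := true) (x := x) (by simpa using hx)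
  · exact cons (by simpa using hx) hz

theorem right_mul {x z : A} (hx : x ∈ T) (hz : z = 1 ∨ IsAltProd S T true z) :
    IsAltProd S T false (x * z) := by
  rcases hz with rfl | hz
  · simpa using single (S := S) (T := T) (t := false) (x := x) (by simpa using hx)
  · exact cons (by simpa using hx) hz

/-- An alternating word in `a`, `b` with first letter `b`, multiplied on the right by an element
`x` for which `x` and `a * x` are alternating products starting in `S`. -/
theorem word_mul {a b : A} (ha : a ∈ S) (hb : b ∈ T) {x : A}
    (hx : x = 1 ∨ IsAltProd S T true x ∧ IsAltProd S T true (a * x)) :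
    ∀ L : List Bool, (false :: L).IsChain (· ≠ ·) →
      IsAltProd S T false (((false :: L).map (fun t => if t then a else b)).prod * x)
  | [], _ => by
    simpa using right_mul hb (hx.imp_right And.left)
  | [true], _ => by
    have : IsAltProd S T true (a * x) := by
      rcases hx with rfl | hx
      · exact left_mul ha (Or.inl rfl)
      · exact hx.2
    simpa [mul_assoc] using right_mul hb (Or.inr this)
  | true :: false :: L, h => by
    have ih := word_mul ha hb hx L (by simp_all)
    simpa [mul_assoc] using right_mul hb (Or.inr (left_mul ha (Or.inr ih)))
  | true :: true :: L, h => by simp at h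
  | false :: L, h => by simp at h

theorem altWords_mul {a b : A} (ha : a ∈ S) (hb : b ∈ T) {x w : A}
    (hx : x = 1 ∨ IsAltProd S T true x ∧ IsAltProd S T true (a * x))
    (hw : w ∈ altWords a b \ {1, a}) :
    IsAltProd S T false (w * x) ∨ ∃ z, IsAltProd S T false z ∧ w * x = a * z := by
  obtain ⟨⟨L, hL, rfl⟩, hne⟩ := hw
  match L, hL with
  | [], _ => simp at hne
  | [true], _ => simp at hne
  | false :: L, h => exact Or.inl (word_mul ha hb hx L h)
  | true :: false :: L, h =>
    exact Or.inr ⟨_, word_mul ha hb hx L (List.isChain_cons_cons.1 h).2, by simp [mul_assoc]⟩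
  | true :: true :: L, h => exact absurd (List.isChain_cons_cons.1 h).1 (by simp)

/-- Products whose factors lie alternately in `altWords a b \ {1, a}` and in a set `U` all of
whose elements stay in `S` after multiplication by `a` on either or both sides. -/
theorem of_altWords {a b : A} (ha : a ∈ S) (hb : b ∈ T) {U : Set A}
    (hU : ∀ v ∈ U, v ∈ S ∧ a * v ∈ S ∧ v * a ∈ S ∧ a * (v * a) ∈ S) :
    ∀ (m : ℕ) (s : Fin (m + 1) → A) (c : Fin (m + 1) → Bool),
      (∀ i, (c i = true → s i ∈ altWords a b \ {1, a}) ∧ (c i = false → s i ∈ U)) →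
      (∀ i : Fin m, c i.castSucc ≠ c i.succ) →
      (c 0 = true → IsAltProd S T false (List.ofFn s).prod ∨
        ∃ z, IsAltProd S T false z ∧ (List.ofFn s).prod = a * z) ∧
      (c 0 = false → IsAltProd S T true (List.ofFn s).prod ∧
        IsAltProd S T true (a * (List.ofFn s).prod)) := by
  have mul_left {v x : A} (hv : v ∈ U)
      (hx : x = 1 ∨ IsAltProd S T false x ∨ ∃ z, IsAltProd S T false z ∧ x = a * z) :
      IsAltProd S T true (v * x) ∧ IsAltProd S T true (a * (v * x)) := by
    obtain ⟨h1, h2, h3, h4⟩ := hU v hv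
    rw [← or_assoc] at hx
    rcases hx with hx | ⟨z, hz, rfl⟩
    · exact ⟨left_mul h1 hx, mul_assoc a v x ▸ left_mul h2 hx⟩
    · have e : v * (a * z) = v * a * z := (mul_assoc _ _ _).symm
      rw [e, ← mul_assoc a]
      exact ⟨left_mul h3 (Or.inr hz), left_mul h4 (Or.inr hz)⟩
  intro m
  induction m with
  | zero =>
    intro s c hs _
    have e : (List.ofFn s).prod = s 0 * 1 := by simp
    rw [e]
    exact ⟨fun h => altWords_mul ha hb (Or.inl rfl) ((hs 0).1 h),
      fun h => mul_left ((hs 0).2 h) (Or.inl rfl)⟩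
  | succ m ih =>
    intro s c hs hc
    obtain ⟨ih1, ih2⟩ := ih (fun i => s i.succ) (fun i => c i.succ) (fun i => hs i.succ)
      (fun i => hc i.succ)
    have h01 : c 0 ≠ c (Fin.succ 0) := hc 0
    rw [List.ofFn_succ, List.prod_cons]
    refine ⟨fun h => altWords_mul ha hb (Or.inr (ih2 ?_)) ((hs 0).1 h),
      fun h => mul_left ((hs 0).2 h) (Or.inr (ih1 ?_))⟩
    · rw [h] at h01; simpa using h01.symm
    · rw [h] at h01; simpa using h01.symm

end IsAltProd

theorem FreeOn.apply_eq_zero {A R : Type*} [Monoid A] [Zero R] {φ : A → R} {S T : Set A}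
    (h : FreeOn φ S T) {t : Bool} {x : A} (hx : IsAltProd S T t x) : φ x = 0 := by
  obtain ⟨n, y, c, hy, hc, -, rfl⟩ := hx
  exact h n y c hy hc

/-- The kernel of a positive functional on a complex unital ∗-algebra is ∗-closed. -/
theorem map_star_eq_zero_of_nonneg {M : Type*} [Ring M] [StarRing M] [Algebra ℂ M]
    [StarModule ℂ M] (ω : M →ₗ[ℂ] ℂ) (hω : ∀ x : M, 0 ≤ ω (star x * x)) {x : M}
    (hx : ω x = 0) : ω (star x) = 0 := by
  have im (y : M) : (ω (star y * y)).im = 0 := (Complex.nonneg_iff.1 (hω y)).2.symm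
  have h0 := im 1
  have hx0 := im x
  have h1 := im (1 + x)
  have h2 := im (1 + Complex.I • x)
  simp only [star_add, star_one, star_smul, add_mul, mul_add, one_mul, mul_one, map_add,
    smul_mul_assoc, mul_smul_comm, map_smul, hx, Complex.add_im] at h0 h1 h2
  simp [hx0] at h0 h1 h2
  apply Complex.ext <;> simp <;> linarith

/-- Dykema's algebraic trick.  Let `A`, `B` be unital ∗-subalgebras,
free with respect to a state `ω`, `a ∈ A°`, `b ∈ B°`, and let `u ∈ A` with `ω(u) = 0`
satisfy `au = μ₁u`, `ua = μ₂u`, `au* = μ₃u*`, `u*a = μ₄u*`.  Then `ω` vanishes on every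
nontrivial product `s = s₁ ⋯ s_m` whose factors lie alternately in
`Λ({a},{b}) ∖ {1, a}` and in `{u, u*}`, with at least one factor in `{u, u*}`. -/
theorem traveling_products_vanish
    {M : Type*} [Ring M] [StarRing M] [Algebra ℂ M] [StarModule ℂ M]
    (ω : M →ₗ[ℂ] ℂ)
    -- `ω` is a state
    (hω1 : ω 1 = 1)
    (hωpos : ∀ x : M, 0 ≤ ω (star x * x))
    -- `A` and `B` are unital ∗-subalgebras, free with respect to `ω`
    (A B : StarSubalgebra ℂ M)
    (hfree : FreeOn ω {m | m ∈ A ∧ ω m = 0} {m | m ∈ B ∧ ω m = 0})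
    (a b u : M)
    (haA : a ∈ A) (hωa : ω a = 0)
    (hbB : b ∈ B) (hωb : ω b = 0)
    (huA : u ∈ A) (hωu : ω u = 0)
    (μ₁ μ₂ μ₃ μ₄ : ℂ)
    (h₁ : a * u = μ₁ • u) (h₂ : u * a = μ₂ • u)
    (h₃ : a * star u = μ₃ • star u) (h₄ : star u * a = μ₄ • star u) :
    ∀ (m : ℕ) (s : Fin (m + 1) → M) (c : Fin (m + 1) → Bool),
      (∀ i, (c i = true → s i ∈ altWords a b \ {1, a}) ∧
        (c i = false → s i ∈ ({u, star u} : Set M))) →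
      (∀ i : Fin m, c i.castSucc ≠ c i.succ) →
      (∃ i, c i = false) →
      ω (List.ofFn s).prod = 0 := by
  intro m s c hs hc _
  have hωu' : ω (star u) = 0 := map_star_eq_zero_of_nonneg ω hωpos hωu
  have huA' : star u ∈ A := star_mem huA
  have absorb {v : M} {μ ν : ℂ} (hv : v ∈ A) (hωv : ω v = 0) (hl : a * v = μ • v)
      (hr : v * a = ν • v) :
      (v ∈ A ∧ ω v = 0) ∧ (a * v ∈ A ∧ ω (a * v) = 0) ∧ (v * a ∈ A ∧ ω (v * a) = 0) ∧
        (a * (v * a) ∈ A ∧ ω (a * (v * a)) = 0) :=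
    ⟨⟨hv, hωv⟩, ⟨mul_mem haA hv, by simp [hl, hωv]⟩, ⟨mul_mem hv haA, by simp [hr, hωv]⟩,
      ⟨mul_mem haA (mul_mem hv haA), by simp [hr, hl, hωv]⟩⟩
  have key := IsAltProd.of_altWords (S := {m | m ∈ A ∧ ω m = 0}) (T := {m | m ∈ B ∧ ω m = 0})
    (U := {u, star u}) ⟨haA, hωa⟩ ⟨hbB, hωb⟩ (by
      rintro v (rfl | rfl)
      · exact absorb huA hωu h₁ h₂
      · exact absorb huA' hωu' h₃ h₄) m s c hs hc
  cases h : c 0 with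
  | false => exact hfree.apply_eq_zero (key.2 h).1
  | true =>
    rcases key.1 h with hp | ⟨z, hz, hp⟩
    · exact hfree.apply_eq_zero hp
    · rw [hp]
      exact hfree.apply_eq_zero (IsAltProd.left_mul ⟨haA, hωa⟩ (Or.inr hz))
end

section
/- For every w ∈ N with ω(w) = 0 and ω(pw) = 0, there exists a sequence (R_k) in the linear span of Λ({a},{b}) ∖ {1, a} with sup_k ‖R_k‖ < ∞ which converges to w in the strong operator topology. -/
open Filter Topology
open scoped ComplexOrder

theorem Submodule.map_starProjection_comm {E : Type*} [NormedAddCommGroup E]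
    [InnerProductSpace ℂ E] (K : Submodule ℂ E) [K.HasOrthogonalProjection] (T T' : E →L[ℂ] E)
    (hT : ∀ v ∈ K, T v ∈ K) (hT' : ∀ v ∈ K, T' v ∈ K)
    (hadj : ∀ u v, inner ℂ (T' u) v = inner ℂ u (T v)) (v : E) :
    K.starProjection (T v) = T (K.starProjection v) := by
  refine Submodule.eq_starProjection_of_mem_orthogonal (hT _ (K.starProjection_apply_mem v)) ?_
  rw [← map_sub, Submodule.mem_orthogonal]
  intro u hu
  rw [← hadj]
  exact (Submodule.mem_orthogonal _ _).1 (K.sub_starProjection_mem_orthogonal v) _ (hT' u hu)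

section Density

variable {H : Type*} [NormedAddCommGroup H] [InnerProductSpace ℂ H]

/-- The orbit map `x ↦ (x ξ_i)_i` into a finite Hilbert sum of copies of `H`. -/
def orbitMap {ι : Type*} [Fintype ι] (ξ : ι → H) :
    (H →L[ℂ] H) →ₗ[ℂ] PiLp 2 (fun _ : ι => H) where
  toFun x := WithLp.toLp 2 fun i => x (ξ i)
  map_add' x y := by ext i; simp
  map_smul' c x := by ext i; simp

/-- The diagonal action of an operator on a finite Hilbert sum of copies of `H`. -/
noncomputable def diagonalOp (ι : Type*) [Fintype ι] (x : H →L[ℂ] H) :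
    PiLp 2 (fun _ : ι => H) →L[ℂ] PiLp 2 (fun _ : ι => H) :=
  (PiLp.continuousLinearEquiv 2 ℂ (fun _ : ι => H)).symm.toContinuousLinearMap ∘L
    (ContinuousLinearMap.pi fun i => x ∘L ContinuousLinearMap.proj i) ∘L
    (PiLp.continuousLinearEquiv 2 ℂ (fun _ : ι => H)).toContinuousLinearMap

theorem diagonalOp_apply {ι : Type*} [Fintype ι] (x : H →L[ℂ] H) (v : PiLp 2 (fun _ : ι => H))
    (i : ι) : diagonalOp ι x v i = x (v i) := by
  simp [diagonalOp]

theorem orbitMap_apply {ι : Type*} [Fintype ι] (ξ : ι → H) (x : H →L[ℂ] H) (i : ι) :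
    orbitMap ξ x i = x (ξ i) := rfl

variable [CompleteSpace H]

theorem inner_diagonalOp_star {ι : Type*} [Fintype ι] (x : H →L[ℂ] H)
    (u v : PiLp 2 (fun _ : ι => H)) :
    inner ℂ (diagonalOp ι (star x) u) v = inner ℂ u (diagonalOp ι x v) := by
  simp only [PiLp.inner_apply, diagonalOp_apply, ContinuousLinearMap.star_eq_adjoint,
    ContinuousLinearMap.adjoint_inner_left]

/-- **von Neumann's density theorem**, for finitely many vectors. -/
theorem exists_seq_tendsto_of_mem_bicommutant (S : StarSubalgebra ℂ (H →L[ℂ] H)) {z : H →L[ℂ] H}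
    (hz : z ∈ Set.centralizer (Set.centralizer (S : Set (H →L[ℂ] H))))
    {ι : Type*} [Fintype ι] (ξ : ι → H) :
    ∃ y : ℕ → H →L[ℂ] H, (∀ n, y n ∈ S) ∧
      ∀ i, Tendsto (fun n => y n (ξ i)) atTop (𝓝 (z (ξ i))) := by
  classical
  set K : Submodule ℂ (PiLp 2 (fun _ : ι => H)) :=
    (S.toSubalgebra.toSubmodule.map (orbitMap ξ)).topologicalClosure with hK
  have hKc : IsClosed (K : Set (PiLp 2 (fun _ : ι => H))) :=
    Submodule.isClosed_topologicalClosure _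
  have : CompleteSpace K := hKc.completeSpace_coe
  have hinv : ∀ x ∈ S, ∀ v ∈ K, diagonalOp ι x v ∈ K := by
    intro x hx v hv
    refine map_mem_closure (diagonalOp ι x).continuous hv ?_
    rintro _ ⟨y, hy, rfl⟩
    exact ⟨x * y, S.mul_mem hx hy, by ext i; simp [diagonalOp_apply, orbitMap_apply]⟩
  have hcomm : ∀ x ∈ S, ∀ v, K.starProjection (diagonalOp ι x v) =
      diagonalOp ι x (K.starProjection v) := fun x hx =>
    K.map_starProjection_comm _ (diagonalOp ι (star x)) (hinv x hx) (hinv _ (star_mem hx))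
      (inner_diagonalOp_star x)
  let Q : ι → ι → H →L[ℂ] H := fun i j =>
    (PiLp.proj 2 (fun _ : ι => H) i : PiLp 2 (fun _ : ι => H) →L[ℂ] H) ∘L K.starProjection ∘L
      (PiLp.continuousLinearEquiv 2 ℂ (fun _ : ι => H)).symm.toContinuousLinearMap ∘L
      ContinuousLinearMap.single ℂ (fun _ : ι => H) j
  have hQ_apply : ∀ i j h, Q i j h = K.starProjection (WithLp.toLp 2 (Pi.single j h)) i := by
    intro i j h; rfl
  have hdiag_single : ∀ (x : H →L[ℂ] H) j h, diagonalOp ι x (WithLp.toLp 2 (Pi.single j h)) =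
      WithLp.toLp 2 (Pi.single j (x h)) := by
    intro x j h
    ext i
    rw [diagonalOp_apply]
    by_cases hij : i = j
    · subst hij; simp
    · simp [hij]
  have hQ : ∀ i j, Q i j ∈ Set.centralizer (S : Set (H →L[ℂ] H)) := by
    intro i j x hx
    ext h
    change x (Q i j h) = Q i j (x h)
    rw [hQ_apply, hQ_apply, ← hdiag_single, hcomm x hx, diagonalOp_apply]
  have hzQ : ∀ i j h, z (Q i j h) = Q i j (z h) := fun i j h =>
    (congrArg (fun T : H →L[ℂ] H => T h) (hz _ (hQ i j))).symm
  have hzcomm : ∀ v, K.starProjection (diagonalOp ι z v) =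
      diagonalOp ι z (K.starProjection v) := by
    intro v
    have hv : v = ∑ j, WithLp.toLp 2 (Pi.single j (v j)) := by
      ext i
      simp [Finset.sum_apply, Pi.single_apply]
    rw [hv]
    simp only [map_sum]
    refine Finset.sum_congr rfl fun j _ => ?_
    ext i
    rw [hdiag_single, diagonalOp_apply, ← hQ_apply, ← hQ_apply, hzQ]
  have h1 : orbitMap ξ 1 ∈ K := Submodule.le_topologicalClosure _ ⟨1, S.one_mem, rfl⟩
  have hzK : orbitMap ξ z ∈ K := by
    have : orbitMap ξ z = K.starProjection (diagonalOp ι z (orbitMap ξ 1)) := by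
      rw [hzcomm, Submodule.starProjection_eq_self_iff.2 h1]
      ext i; simp [diagonalOp_apply, orbitMap_apply]
    rw [this]
    exact K.starProjection_apply_mem _
  obtain ⟨u, hu, hlim⟩ := mem_closure_iff_seq_limit.1 hzK
  choose y hy hyu using hu
  refine ⟨y, hy, fun i => ?_⟩
  have := ((PiLp.proj 2 (fun _ : ι => H) i :
    PiLp 2 (fun _ : ι => H) →L[ℂ] H).continuous.tendsto _).comp hlim
  simpa [Function.comp_def, ← hyu, orbitMap_apply] using this

theorem exists_seq_isSelfAdjoint_tendsto_of_mem_bicommutant (S : StarSubalgebra ℂ (H →L[ℂ] H))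
    {z : H →L[ℂ] H} (hz : z ∈ Set.centralizer (Set.centralizer (S : Set (H →L[ℂ] H))))
    (hzsa : IsSelfAdjoint z) {ι : Type*} [Fintype ι] (ξ : ι → H) :
    ∃ y : ℕ → H →L[ℂ] H, (∀ n, y n ∈ S ∧ IsSelfAdjoint (y n)) ∧
      ∀ i, Tendsto (fun n => y n (ξ i)) atTop (𝓝 (z (ξ i))) := by
  set C : Set (PiLp 2 (fun _ : ι => H)) :=
    closure (orbitMap ξ '' {y | y ∈ S ∧ IsSelfAdjoint y}) with hC
  have hconv : Convex ℝ C := by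
    refine Convex.closure ?_
    rintro _ ⟨x, ⟨hx, hx'⟩, rfl⟩ _ ⟨y, ⟨hy, hy'⟩, rfl⟩ s t - - -
    refine ⟨(s : ℂ) • x + (t : ℂ) • y,
      ⟨S.add_mem (S.smul_mem hx _) (S.smul_mem hy _), ?_⟩, ?_⟩
    · exact (IsSelfAdjoint.smul (Complex.conj_ofReal s) hx').add
        (IsSelfAdjoint.smul (Complex.conj_ofReal t) hy')
    · rw [map_add, map_smul, map_smul]; rfl
  have hzC : orbitMap ξ z ∈ C := by
    by_contra hcon
    obtain ⟨f, u, hfu, huz⟩ :=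
      RCLike.geometric_hahn_banach_closed_point (𝕜 := ℂ) hconv isClosed_closure hcon
    set η : PiLp 2 (fun _ : ι => H) := (InnerProductSpace.toDual ℂ _).symm f with hη
    have hf : ∀ v, f v = ∑ i, inner ℂ (η i) (v i) := fun v => by
      rw [← PiLp.inner_apply, hη, InnerProductSpace.toDual_symm_apply]
    obtain ⟨y, hyS, hy⟩ := exists_seq_tendsto_of_mem_bicommutant S hz (Sum.elim ξ fun i => η i)
    have hre : ∀ x : H →L[ℂ] H, RCLike.re (f (orbitMap ξ ((2⁻¹ : ℂ) • (x + star x)))) =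
        RCLike.re (∑ i, (2⁻¹ : ℂ) * (inner ℂ (η i) (x (ξ i)) + inner ℂ (x (η i)) (ξ i))) := by
      intro x
      rw [hf]
      simp only [orbitMap_apply, smul_apply, add_apply,
        inner_smul_right, inner_add_right, ContinuousLinearMap.star_eq_adjoint,
        ContinuousLinearMap.adjoint_inner_right]
    have hlim : Tendsto (fun n => RCLike.re (f (orbitMap ξ ((2⁻¹ : ℂ) • (y n + star (y n))))))
        atTop (𝓝 (RCLike.re (f (orbitMap ξ ((2⁻¹ : ℂ) • (z + star z)))))) := by
      simp only [hre]
      refine (RCLike.continuous_re.tendsto _).comp (tendsto_finsetSum _ fun i _ => ?_)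
      exact ((tendsto_const_nhds.inner (hy (Sum.inl i))).add
        ((hy (Sum.inr i)).inner tendsto_const_nhds)).const_mul _
    have hz2 : (2⁻¹ : ℂ) • (z + star z) = z := by
      rw [hzsa.star_eq, ← two_smul ℂ z, smul_smul]; norm_num
    rw [hz2] at hlim
    refine (le_of_tendsto hlim (Eventually.of_forall fun n => (hfu _ ?_).le)).not_gt huz
    refine subset_closure ⟨_, ⟨S.smul_mem (S.add_mem (hyS n) (S.star_mem' (hyS n))) _, ?_⟩, rfl⟩
    exact IsSelfAdjoint.smul (by simp [IsSelfAdjoint]) (IsSelfAdjoint.add_star_self _)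
  obtain ⟨u, hu, hlim⟩ := mem_closure_iff_seq_limit.1 hzC
  choose y hy hyu using hu
  refine ⟨y, hy, fun i => ?_⟩
  have := ((PiLp.proj 2 (fun _ : ι => H) i :
    PiLp 2 (fun _ : ι => H) →L[ℂ] H).continuous.tendsto _).comp hlim
  simpa [Function.comp_def, ← hyu, orbitMap_apply] using this

theorem cfc_mem_bicommutant {T : Set (H →L[ℂ] H)} {w : H →L[ℂ] H}
    (hw : w ∈ Set.centralizer (Set.centralizer T)) (hwsa : IsSelfAdjoint w) (f : ℝ → ℝ) :
    cfc f w ∈ Set.centralizer (Set.centralizer T) := by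
  intro x hx
  have h : Commute w x := (hw x hx).symm
  exact (hwsa.commute_cfc h f).symm.eq

/-- The transform `y ↦ 2 y (1 + y²)⁻¹` used in the proof of Kaplansky's theorem. -/
noncomputable def kaplanskyTransform (y : H →L[ℂ] H) : H →L[ℂ] H :=
  cfc (fun t : ℝ => 2 * t / (1 + t ^ 2)) y

theorem continuous_one_add_sq_inv : Continuous fun t : ℝ => (1 + t ^ 2)⁻¹ :=
  Continuous.inv₀ (by fun_prop) fun t => by positivity

theorem exists_resolvent (y : H →L[ℂ] H) (hy : IsSelfAdjoint y) :
    ∃ r : H →L[ℂ] H, kaplanskyTransform y = (2 : ℂ) • (y * r) ∧ y * r = r * y ∧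
      r * (1 + y * y) = 1 ∧ (1 + y * y) * r = 1 ∧ ‖r‖ ≤ 1 ∧ ‖r * y‖ ≤ 1 := by
  have hc := continuous_one_add_sq_inv
  have hcomm : Commute (cfc (fun t : ℝ => (1 + t ^ 2)⁻¹) y) y := hy.commute_cfc (Commute.refl y) _
  have hone : (1 + y * y) = cfc (fun t : ℝ => 1 + t ^ 2) y := by
    rw [cfc_const_add (1 : ℝ) (fun t => t ^ 2) y, cfc_pow_id y 2, map_one, pow_two]
  have hinv : cfc (fun t : ℝ => (1 + t ^ 2)⁻¹) y * (1 + y * y) = 1 := by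
    rw [hone, ← cfc_mul _ _ y hc.continuousOn (by fun_prop), ← cfc_one ℝ y]
    refine cfc_congr fun t _ => ?_
    have : (1 + t ^ 2) ≠ 0 := by positivity
    simp [this]
  have hmul : cfc (fun t : ℝ => (1 + t ^ 2)⁻¹) y * y = cfc (fun t : ℝ => (1 + t ^ 2)⁻¹ * t) y := by
    conv_lhs => rw [← cfc_id' ℝ y]
    rw [cfc_id' ℝ y, cfc_mul _ _ y hc.continuousOn (by fun_prop), cfc_id' ℝ y]
  refine ⟨cfc (fun t : ℝ => (1 + t ^ 2)⁻¹) y, ?_, hcomm.symm.eq, hinv, ?_, ?_, ?_⟩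
  · rw [hcomm.symm.eq, hmul, kaplanskyTransform]
    have : ∀ x : H →L[ℂ] H, (2 : ℂ) • x = (2 : ℝ) • x := fun x => by
      rw [two_smul, two_smul]
    rw [this, ← cfc_smul (2 : ℝ) _ y (by exact (hc.mul continuous_id).continuousOn)]
    refine cfc_congr fun t _ => ?_
    simp only [smul_eq_mul]
    ring
  · exact (((Commute.one_right _).add_right (hcomm.mul_right hcomm)).symm).eq.trans hinv
  · refine norm_cfc_le zero_le_one fun t _ => ?_
    rw [Real.norm_of_nonneg (by positivity)]
    exact inv_le_one_of_one_le₀ (by nlinarith)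
  · rw [hmul]
    refine norm_cfc_le zero_le_one fun t _ => ?_
    rw [Real.norm_eq_abs, abs_mul, abs_of_nonneg (by positivity : 0 ≤ (1 + t ^ 2)⁻¹),
      inv_mul_le_iff₀ (by positivity)]
    nlinarith [sq_nonneg (|t| - 1), sq_abs t]

theorem norm_kaplanskyTransform_sub_apply_le {y z r s : H →L[ℂ] H}
    (hy : kaplanskyTransform y = (2 : ℂ) • (y * r)) (hyr : y * r = r * y)
    (hry : r * (1 + y * y) = 1) (hr : ‖r‖ ≤ 1) (hry' : ‖r * y‖ ≤ 1)
    (hz : kaplanskyTransform z = (2 : ℂ) • (z * s)) (hzs : (1 + z * z) * s = 1) (ξ : H) :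
    ‖kaplanskyTransform y ξ - kaplanskyTransform z ξ‖ ≤
      2 * (‖y (s ξ) - z (s ξ)‖ + ‖y (z (s ξ)) - z (z (s ξ))‖) := by
  have key : kaplanskyTransform y - kaplanskyTransform z =
      (2 : ℂ) • (r * ((y - z) * s) - (r * y) * ((y - z) * (z * s))) := by
    rw [hy, hz, ← smul_sub]
    congr 1
    have h1 : y * r = r * y * ((1 + z * z) * s) := by rw [hzs, mul_one, hyr]
    have h2 : z * s = r * (1 + y * y) * (z * s) := by rw [hry, one_mul]
    rw [h1]
    conv_lhs => rw [h2]
    noncomm_ring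
  have key' := congrArg (fun T : H →L[ℂ] H => T ξ) key
  simp only [sub_apply, smul_apply] at key'
  rw [key', norm_smul, Complex.norm_ofNat]
  gcongr
  refine (norm_sub_le _ _).trans (add_le_add ?_ ?_)
  · exact (r.le_of_opNorm_le hr _).trans_eq (one_mul _)
  · exact ((r * y).le_of_opNorm_le hry' _).trans_eq (one_mul _)

theorem norm_kaplanskyTransform_le (y : H →L[ℂ] H) : ‖kaplanskyTransform y‖ ≤ 1 := by
  refine norm_cfc_le zero_le_one fun t _ => ?_
  rw [Real.norm_eq_abs, abs_div, abs_of_nonneg (by positivity : 0 ≤ 1 + t ^ 2),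
    div_le_one (by positivity), abs_mul, abs_two]
  nlinarith [sq_nonneg (|t| - 1), sq_abs t]

theorem exists_kaplanskyTransform_eq {T : Set (H →L[ℂ] H)} {w : H →L[ℂ] H}
    (hw : w ∈ Set.centralizer (Set.centralizer T)) (hwsa : IsSelfAdjoint w) (hw1 : ‖w‖ ≤ 1) :
    ∃ z ∈ Set.centralizer (Set.centralizer T), IsSelfAdjoint z ∧ kaplanskyTransform z = w := by
  have hg : Continuous fun t : ℝ => t / (1 + √(1 - t ^ 2)) :=
    continuous_id.div (by fun_prop) fun t => by positivity
  have hf : Continuous fun t : ℝ => 2 * t / (1 + t ^ 2) :=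
    Continuous.div (by fun_prop) (by fun_prop) fun t => by positivity
  refine ⟨cfc (fun t : ℝ => t / (1 + √(1 - t ^ 2))) w, cfc_mem_bicommutant hw hwsa _,
    cfc_predicate _ w, ?_⟩
  rw [kaplanskyTransform, ← cfc_comp' _ _ w hf.continuousOn hg.continuousOn]
  conv_rhs => rw [← cfc_id' ℝ w]
  refine cfc_congr fun t ht => ?_
  have ht1 : |t| ≤ 1 := by
    have := (spectrum.norm_le_norm_mul_of_mem ht).trans
      (mul_le_mul hw1 (ContinuousLinearMap.norm_id_le) (norm_nonneg _) zero_le_one)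
    simpa using this
  have hs : √(1 - t ^ 2) ^ 2 = 1 - t ^ 2 := Real.sq_sqrt (by nlinarith [sq_abs t, abs_nonneg t])
  have hs0 := Real.sqrt_nonneg (1 - t ^ 2)
  set s := √(1 - t ^ 2)
  have h1 : 1 + s ≠ 0 := by positivity
  have h2 : (1 + s) ^ 2 + t ^ 2 ≠ 0 := by positivity
  have ht2 : t ^ 2 = 1 - s ^ 2 := by linarith
  field_simp
  rw [ht2]
  ring

/-- Kaplansky's density theorem for self-adjoint contractions and finitely many vectors, with a
non-optimal constant. -/
theorem exists_bounded_seq_of_isSelfAdjoint (S : StarSubalgebra ℂ (H →L[ℂ] H)) {w : H →L[ℂ] H}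
    (hw : w ∈ Set.centralizer (Set.centralizer (S : Set (H →L[ℂ] H))))
    (hwsa : IsSelfAdjoint w) (hw1 : ‖w‖ ≤ 1) {ι : Type*} [Fintype ι] (ξ : ι → H) :
    ∃ x : ℕ → H →L[ℂ] H, (∀ n, x n ∈ S ∧ ‖x n‖ ≤ 2) ∧
      ∀ i, Tendsto (fun n => x n (ξ i)) atTop (𝓝 (w (ξ i))) := by
  obtain ⟨z, hz, hzsa, rfl⟩ := exists_kaplanskyTransform_eq hw hwsa hw1
  obtain ⟨s, hzs, -, -, hs, -, -⟩ := exists_resolvent z hzsa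
  obtain ⟨y, hy, hylim⟩ := exists_seq_isSelfAdjoint_tendsto_of_mem_bicommutant S hz hzsa
    (Sum.elim (fun i => s (ξ i)) fun i => z (s (ξ i)))
  have hx : ∀ n : ℕ, ∃ x ∈ S, ‖kaplanskyTransform (y n) - x‖ < 1 / ((n : ℝ) + 1) := by
    intro n
    have hmem : kaplanskyTransform (y n) ∈ S.topologicalClosure :=
      have : IsClosed (S.topologicalClosure : Set (H →L[ℂ] H)) := S.isClosed_topologicalClosure
      cfc_mem _ (S.le_topologicalClosure (hy n).1)
    obtain ⟨x, hxS, hx⟩ := Metric.mem_closure_iff.1 hmem (1 / ((n : ℝ) + 1)) (by positivity)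
    exact ⟨x, hxS, by rwa [dist_eq_norm] at hx⟩
  choose x hxS hxy using hx
  refine ⟨x, fun n => ⟨hxS n, ?_⟩, fun i => ?_⟩
  · have h1 : 1 / ((n : ℝ) + 1) ≤ 1 := by
      rw [div_le_one (by positivity)]; linarith [n.cast_nonneg (α := ℝ)]
    calc ‖x n‖ = ‖kaplanskyTransform (y n) - (kaplanskyTransform (y n) - x n)‖ := by
          rw [sub_sub_cancel]
      _ ≤ 1 + 1 := (norm_sub_le _ _).trans
          (add_le_add (norm_kaplanskyTransform_le _) ((hxy n).le.trans h1))
      _ = 2 := by norm_num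
  · rw [tendsto_iff_norm_sub_tendsto_zero]
    refine squeeze_zero (g := fun n : ℕ => 1 / ((n : ℝ) + 1) * ‖ξ i‖ +
      2 * (‖y n (s (ξ i)) - z (s (ξ i))‖ + ‖y n (z (s (ξ i))) - z (z (s (ξ i)))‖))
      (fun _ => norm_nonneg _) (fun n => ?_) ?_
    · obtain ⟨r, h1, h2, h3, -, h4, h5⟩ := exists_resolvent (y n) (hy n).2
      refine (norm_sub_le_norm_sub_add_norm_sub _ (kaplanskyTransform (y n) (ξ i)) _).trans
        (add_le_add ?_ (norm_kaplanskyTransform_sub_apply_le h1 h2 h3 h4 h5 hzs hs _))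
      rw [norm_sub_rev]
      exact (kaplanskyTransform (y n) - x n).le_of_opNorm_le (hxy n).le _
    · have h1 := tendsto_iff_norm_sub_tendsto_zero.1 (hylim (Sum.inl i))
      have h2 := tendsto_iff_norm_sub_tendsto_zero.1 (hylim (Sum.inr i))
      have h3 := tendsto_one_div_add_atTop_nhds_zero_nat (𝕜 := ℝ)
      simpa using (h3.mul_const ‖ξ i‖).add ((h1.add h2).const_mul 2)

theorem exists_bounded_seq_of_mem_bicommutant (S : StarSubalgebra ℂ (H →L[ℂ] H)) {w : H →L[ℂ] H}
    (hw : w ∈ Set.centralizer (Set.centralizer (S : Set (H →L[ℂ] H)))) :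
    ∃ c : ℝ, ∀ {ι : Type} [Fintype ι] (ξ : ι → H),
      ∃ x : ℕ → H →L[ℂ] H, (∀ n, x n ∈ S ∧ ‖x n‖ ≤ c) ∧
        ∀ i, Tendsto (fun n => x n (ξ i)) atTop (𝓝 (w (ξ i))) := by
  have hw' : w ∈ StarSubalgebra.centralizer ℂ
      (StarSubalgebra.centralizer ℂ (S : Set (H →L[ℂ] H)) : Set (H →L[ℂ] H)) := by
    rw [← SetLike.mem_coe, StarSubalgebra.coe_centralizer_centralizer]
    simpa using hw
  have hscale : ∀ v : H →L[ℂ] H, IsSelfAdjoint v →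
      v ∈ Set.centralizer (Set.centralizer (S : Set (H →L[ℂ] H))) →
      ∀ {ι : Type} [Fintype ι] (ξ : ι → H),
        ∃ x : ℕ → H →L[ℂ] H, (∀ n, x n ∈ S ∧ ‖x n‖ ≤ (‖v‖ + 1) * 2) ∧
          ∀ i, Tendsto (fun n => x n (ξ i)) atTop (𝓝 (v (ξ i))) := by
    intro v hv hvm ι _ ξ
    have hpos : 0 < ‖v‖ + 1 := by positivity
    have hd : ((‖v‖ + 1 : ℝ) : ℂ) ≠ 0 := by exact_mod_cast hpos.ne'
    have hnorm : ‖(((‖v‖ + 1 : ℝ) : ℂ))‖ = ‖v‖ + 1 := by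
      rw [Complex.norm_real, Real.norm_of_nonneg hpos.le]
    obtain ⟨x, hx, hlim⟩ := exists_bounded_seq_of_isSelfAdjoint S
      (w := (((‖v‖ + 1 : ℝ) : ℂ)⁻¹) • v)
      ((Subalgebra.centralizer ℂ _).smul_mem hvm _)
      (IsSelfAdjoint.smul (by simp [IsSelfAdjoint]) hv)
      (by
        rw [norm_smul, norm_inv, hnorm, inv_mul_le_iff₀ hpos]
        linarith) ξ
    refine ⟨fun n => ((‖v‖ + 1 : ℝ) : ℂ) • x n, fun n => ⟨S.smul_mem (hx n).1 _, ?_⟩, fun i => ?_⟩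
    · rw [norm_smul, hnorm]
      exact mul_le_mul_of_nonneg_left (hx n).2 hpos.le
    · have := (hlim i).const_smul (((‖v‖ + 1 : ℝ) : ℂ))
      simpa only [smul_apply, smul_inv_smul₀ hd] using this
  have hstar : star w ∈ Set.centralizer (Set.centralizer (S : Set (H →L[ℂ] H))) := by
    have := star_mem hw'
    rw [← SetLike.mem_coe, StarSubalgebra.coe_centralizer_centralizer] at this
    simpa using this
  set C := Subalgebra.centralizer ℂ (Set.centralizer (S : Set (H →L[ℂ] H)))
  have hwC : w ∈ C := hw
  have hdec : (2⁻¹ : ℂ) • ((w + star w) + (-Complex.I) • (Complex.I • (w - star w))) = w := by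
    rw [smul_smul, neg_mul, Complex.I_mul_I, neg_neg, one_smul, add_add_sub_cancel,
      ← two_smul ℂ w, smul_smul]
    norm_num
  have hsC : star w ∈ C := hstar
  refine ⟨(‖w + star w‖ + 1) * 2 + (‖Complex.I • (w - star w)‖ + 1) * 2, fun {ι} _ ξ => ?_⟩
  obtain ⟨x, hx, hxl⟩ := hscale (w + star w) (IsSelfAdjoint.add_star_self w) (C.add_mem hwC hsC) ξ
  obtain ⟨y, hy, hyl⟩ := hscale (Complex.I • (w - star w))
    (by simp [IsSelfAdjoint, ← smul_neg]) (C.smul_mem (C.sub_mem hwC hsC) _) ξ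
  refine ⟨fun n => (2⁻¹ : ℂ) • (x n + (-Complex.I) • y n),
    fun n => ⟨S.smul_mem (S.add_mem (hx n).1 (S.smul_mem (hy n).1 _)) _, ?_⟩, fun i => ?_⟩
  · have h1 := (hx n).2
    have h2 := (hy n).2
    have h3 := norm_add_le (x n) ((-Complex.I) • y n)
    rw [norm_smul (-Complex.I), norm_neg, Complex.norm_I, one_mul] at h3
    rw [norm_smul, norm_inv, Complex.norm_ofNat]
    linarith [norm_nonneg (x n + (-Complex.I) • y n)]
  · have := ((hxl i).add ((hyl i).const_smul (-Complex.I))).const_smul (2⁻¹ : ℂ)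
    have hw2 := congrArg (fun T : H →L[ℂ] H => T (ξ i)) hdec
    exact hw2 ▸ this

theorem starProjection_orbit_mem_bicommutant (S : StarSubalgebra ℂ (H →L[ℂ] H)) (ξ : H) :
    ∃ e : H →L[ℂ] H, e ∈ Set.centralizer (Set.centralizer (S : Set (H →L[ℂ] H))) ∧
      star e = e ∧ e * e = e ∧ e ξ = ξ ∧
      ∀ η, (∀ x ∈ Set.centralizer (S : Set (H →L[ℂ] H)), inner ℂ (x ξ) η = 0) → e η = 0 := by
  set C := StarSubalgebra.centralizer ℂ (S : Set (H →L[ℂ] H)) with hC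
  have hmem : ∀ x, x ∈ C ↔ x ∈ Set.centralizer (S : Set (H →L[ℂ] H)) := fun x => by
    rw [← SetLike.mem_coe, StarSubalgebra.coe_centralizer]
    simp
  set L : (H →L[ℂ] H) →ₗ[ℂ] H := (ContinuousLinearMap.apply ℂ H ξ).toLinearMap with hL
  set K : Submodule ℂ H := (C.toSubalgebra.toSubmodule.map L).topologicalClosure
  have : CompleteSpace K :=
    (Submodule.isClosed_topologicalClosure (C.toSubalgebra.toSubmodule.map L)).completeSpace_coe
  have hinv : ∀ x ∈ C, ∀ v ∈ K, x v ∈ K := by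
    intro x hx v hv
    refine map_mem_closure x.continuous hv ?_
    rintro _ ⟨y, hy, rfl⟩
    exact ⟨x * y, C.mul_mem hx hy, rfl⟩
  have hstar : star K.starProjection = K.starProjection := isSelfAdjoint_starProjection K
  refine ⟨K.starProjection, fun x hx => ?_, hstar, K.isIdempotentElem_starProjection, ?_, ?_⟩
  · ext v
    have hxC : x ∈ C := (hmem x).2 hx
    exact (K.map_starProjection_comm x (star x) (hinv x hxC) (hinv _ (star_mem hxC))
      (fun u v => by rw [ContinuousLinearMap.star_eq_adjoint,
        ContinuousLinearMap.adjoint_inner_left]) v).symm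
  · exact Submodule.starProjection_eq_self_iff.2
      (Submodule.le_topologicalClosure _ ⟨1, C.one_mem, rfl⟩)
  · intro η hη
    rw [Submodule.starProjection_apply_eq_zero_iff, Submodule.orthogonal_closure,
      Submodule.mem_orthogonal]
    rintro _ ⟨x, hx, rfl⟩
    exact hη x ((hmem x).1 hx)

/-- A von Neumann algebra carrying a faithful positive functional has a countable cyclic set of
vectors for its commutant. -/
theorem exists_seq_forall_inner_eq_zero (S : StarSubalgebra ℂ (H →L[ℂ] H))
    (ω : (H →L[ℂ] H) →ₗ[ℂ] ℂ)
    (hpos : ∀ m ∈ Set.centralizer (Set.centralizer (S : Set (H →L[ℂ] H))), 0 ≤ ω (star m * m))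
    (hfaith : ∀ m ∈ Set.centralizer (Set.centralizer (S : Set (H →L[ℂ] H))),
      ω (star m * m) = 0 → m = 0) :
    ∃ ξ : ℕ → H, ∀ η, (∀ i, ∀ x ∈ Set.centralizer (S : Set (H →L[ℂ] H)),
      inner ℂ (x (ξ i)) η = 0) → η = 0 := by
  set C := Set.centralizer (S : Set (H →L[ℂ] H)) with hC
  have hCmul : ∀ x ∈ C, ∀ y ∈ C, star x * y ∈ C := by
    have hmem : ∀ x, x ∈ StarSubalgebra.centralizer ℂ (S : Set (H →L[ℂ] H)) ↔ x ∈ C := fun x => by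
      rw [← SetLike.mem_coe, StarSubalgebra.coe_centralizer]
      simp [hC]
    intro x hx y hy
    rw [← hmem] at hx hy ⊢
    exact mul_mem (star_mem hx) hy
  obtain ⟨T, hT⟩ := zorn_subset
    {T : Set H | (0 : H) ∉ T ∧ T.Pairwise fun ξ η => ∀ x ∈ C, inner ℂ (x ξ) η = 0} (by
      intro c hc hchain
      refine ⟨⋃₀ c, ⟨?_, ?_⟩, fun s hs => Set.subset_sUnion_of_mem hs⟩
      · rintro ⟨s, hs, h0⟩
        exact (hc hs).1 h0
      · exact (Set.pairwise_sUnion hchain.directedOn).2 fun s hs => (hc hs).2)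
  obtain ⟨⟨h0, hpair⟩, hmax⟩ := hT
  have horth : ∀ η, (∀ ξ ∈ T, ∀ x ∈ C, inner ℂ (x ξ) η = 0) → η = 0 := by
    intro η hη
    by_contra hne
    have h1 : (1 : H →L[ℂ] H) ∈ C := Set.one_mem_centralizer
    have hηT : η ∈ T := by
      refine hmax ⟨?_, ?_⟩ (Set.subset_insert η T) (Set.mem_insert _ _)
      · rintro (h | h)
        · exact hne h.symm
        · exact h0 h
      · refine hpair.insert fun ξ hξ _ => ⟨fun x hx => ?_, hη ξ hξ⟩
        have hsx : star x ∈ C := by simpa using hCmul x hx 1 h1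
        have := hη ξ hξ _ hsx
        rw [ContinuousLinearMap.star_eq_adjoint, ContinuousLinearMap.adjoint_inner_left] at this
        rw [← inner_conj_symm, this, map_zero]
    exact hne (inner_self_eq_zero.1 (hη η hηT 1 h1))
  have hcount : T.Countable := by
    choose e heN hes hei heξ heη using starProjection_orbit_mem_bicommutant S
    set A := Subalgebra.centralizer ℂ C
    have heA : ∀ ξ, e ξ ∈ A := heN
    have heO : ∀ ξ ∈ T, ∀ η ∈ T, ξ ≠ η → e ξ * e η = 0 := by
      intro ξ hξ η hη hne
      have key : ∀ x ∈ C, e ξ (x η) = 0 := by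
        intro x hx
        refine heη ξ _ fun y hy => ?_
        have := hpair hξ hη hne _ (hCmul x hx y hy)
        rwa [mul_apply_eq_comp, ContinuousLinearMap.star_eq_adjoint,
          ContinuousLinearMap.adjoint_inner_left] at this
      have : e η * e ξ = 0 := by
        ext v
        refine heη η _ fun x hx => ?_
        change inner ℂ (x η) (e ξ v) = 0
        rw [← hes ξ, ContinuousLinearMap.star_eq_adjoint, ContinuousLinearMap.adjoint_inner_right,
          key x hx, inner_zero_left]
      have h2 := congrArg star this
      rwa [star_mul, hes, hes, star_zero] at h2
    have hsum : ∀ F : Finset T, ∑ ξ ∈ F, (ω (e ξ)).re ≤ (ω 1).re := by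
      intro F
      set f := ∑ ξ ∈ F, e ξ with hf
      have hfs : star f = f := by simp [hf, hes]
      have hff : f * f = f := by
        rw [hf, Finset.sum_mul_sum]
        refine Finset.sum_congr rfl fun ξ hξ => ?_
        rw [Finset.sum_eq_single_of_mem ξ hξ, hei]
        exact fun η _ hne => heO _ ξ.2 _ η.2 (Subtype.coe_injective.ne hne.symm)
      have hm : (1 - f) ∈ A := A.sub_mem A.one_mem (A.sum_mem fun ξ _ => heA ξ)
      have := hpos (1 - f) hm
      have hmul : star (1 - f) * (1 - f) = 1 - f := by
        rw [star_sub, star_one, hfs, sub_mul, mul_sub, mul_sub, hff]; simp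
      rw [hmul, map_sub, hf, map_sum] at this
      have := (Complex.le_def.1 this).1
      simpa using this
    have hωpos : ∀ ξ : T, 0 ≤ ω (e ξ) := fun ξ => by
      have := hpos _ (heN ξ)
      rwa [hes, hei] at this
    have hsummable : Summable fun ξ : T => (ω (e ξ)).re :=
      summable_of_sum_le (fun ξ => (Complex.le_def.1 (hωpos ξ)).1) hsum
    have hsupp := hsummable.countable_support
    rw [Function.support_eq_univ] at hsupp
    · exact Set.countable_coe_iff.1 (Set.countable_univ_iff.1 hsupp)
    · intro ξ hξ
      refine h0 ?_
      have : e ξ = 0 := by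
        refine hfaith _ (heN ξ) ?_
        rw [hes, hei]
        refine Complex.ext hξ ?_
        simpa using (Complex.le_def.1 (hωpos ξ)).2.symm
      have h2 := heξ ξ
      rw [this] at h2
      have h3 : (0 : H) = ξ := h2
      exact h3 ▸ ξ.2
  obtain ⟨ξ, hξ⟩ := (hcount.insert 0).exists_eq_range (Set.insert_nonempty _ _)
  refine ⟨ξ, fun η hη => horth η fun ζ hζ => ?_⟩
  obtain ⟨i, rfl⟩ : ζ ∈ Set.range ξ := hξ ▸ Set.mem_insert_of_mem _ hζ
  exact hη i

theorem tendsto_apply_of_tendsto_on_cyclic {S : Set (H →L[ℂ] H)}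
    {R : ℕ → H →L[ℂ] H} {w : H →L[ℂ] H} {c : ℝ} (hR : ∀ k, R k ∈ S) (hRc : ∀ k, ‖R k‖ ≤ c)
    (hw : w ∈ Set.centralizer (Set.centralizer S)) {ξ : ℕ → H}
    (hcyc : ∀ η, (∀ i, ∀ x ∈ Set.centralizer S, inner ℂ (x (ξ i)) η = 0) → η = 0)
    (hlim : ∀ i, Tendsto (fun k => R k (ξ i)) atTop (𝓝 (w (ξ i)))) (v : H) :
    Tendsto (fun k => R k v) atTop (𝓝 (w v)) := by
  set K := Submodule.span ℂ {v | ∃ i, ∃ x ∈ Set.centralizer S, v = x (ξ i)} with hK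
  have hdense : K.topologicalClosure = ⊤ := by
    rw [Submodule.topologicalClosure_eq_top_iff, eq_bot_iff]
    intro η hη
    exact hcyc η fun i x hx => (Submodule.mem_orthogonal _ _).1 hη _
      (Submodule.subset_span ⟨i, x, hx, rfl⟩)
  have hK' : ∀ u ∈ K, Tendsto (fun k => R k u) atTop (𝓝 (w u)) := by
    intro u hu
    induction hu using Submodule.span_induction with
    | mem u hu =>
      obtain ⟨i, x, hx, rfl⟩ := hu
      have h1 : ∀ k, R k (x (ξ i)) = x (R k (ξ i)) := fun k =>
        congrArg (fun T : H →L[ℂ] H => T (ξ i)) (hx _ (hR k))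
      have h2 : w (x (ξ i)) = x (w (ξ i)) :=
        (congrArg (fun T : H →L[ℂ] H => T (ξ i)) (hw x hx)).symm
      simp only [h1, h2]
      exact (x.continuous.tendsto _).comp (hlim i)
    | zero => simp
    | add u u' _ _ h h' => simpa using h.add h'
    | smul a u _ h => simpa using h.const_smul a
  have hc : 0 ≤ c := (norm_nonneg _).trans (hRc 0)
  rw [Metric.tendsto_atTop]
  intro ε hε
  have hv : v ∈ closure (K : Set H) := by
    have : v ∈ K.topologicalClosure := hdense ▸ Submodule.mem_top
    exact this
  obtain ⟨u, hu, huv⟩ := Metric.mem_closure_iff.1 hv (ε / (2 * (c + ‖w‖ + 1))) (by positivity)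
  obtain ⟨n, hn⟩ := Metric.tendsto_atTop.1 (hK' u hu) (ε / 2) (by positivity)
  refine ⟨n, fun k hk => ?_⟩
  have h1 := hn k hk
  rw [dist_eq_norm] at h1 huv ⊢
  have h2 : R k v - w v = R k (v - u) + (R k u - w u) - w (v - u) := by
    simp only [map_sub]; abel
  have h3 := (R k).le_of_opNorm_le (hRc k) (v - u)
  have h4 := w.le_opNorm (v - u)
  have h5 : (c + ‖w‖ + 1) * ‖v - u‖ < ε / 2 := by
    rw [lt_div_iff₀ (by positivity)] at huv
    linarith
  rw [h2]
  refine (norm_sub_le _ _).trans_lt ?_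
  have h6 := norm_add_le (R k (v - u)) (R k u - w u)
  nlinarith [norm_nonneg (v - u)]

/-- Kaplansky's density theorem with sequences, for algebras whose bicommutant carries a faithful
positive functional. -/
theorem exists_bounded_seq_tendsto (S : StarSubalgebra ℂ (H →L[ℂ] H))
    (ω : (H →L[ℂ] H) →ₗ[ℂ] ℂ)
    (hpos : ∀ m ∈ Set.centralizer (Set.centralizer (S : Set (H →L[ℂ] H))), 0 ≤ ω (star m * m))
    (hfaith : ∀ m ∈ Set.centralizer (Set.centralizer (S : Set (H →L[ℂ] H))),
      ω (star m * m) = 0 → m = 0) {w : H →L[ℂ] H}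
    (hw : w ∈ Set.centralizer (Set.centralizer (S : Set (H →L[ℂ] H)))) :
    ∃ (R : ℕ → H →L[ℂ] H) (c : ℝ), (∀ k, R k ∈ S) ∧ (∀ k, ‖R k‖ ≤ c) ∧
      ∀ v, Tendsto (fun k => R k v) atTop (𝓝 (w v)) := by
  obtain ⟨ξ, hξ⟩ := exists_seq_forall_inner_eq_zero S ω hpos hfaith
  obtain ⟨c, hc⟩ := exists_bounded_seq_of_mem_bicommutant S hw
  have hk : ∀ k : ℕ, ∃ x ∈ S, ‖x‖ ≤ c ∧ ∀ i < k, dist (x (ξ i)) (w (ξ i)) < 1 / ((k : ℝ) + 1) := by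
    intro k
    obtain ⟨x, hx, hlim⟩ := hc (fun i : Fin k => ξ i)
    obtain ⟨n, hn⟩ := (eventually_all.2 fun i : Fin k =>
      Metric.tendsto_nhds.1 (hlim i) (1 / ((k : ℝ) + 1)) (by positivity)).exists
    exact ⟨x n, (hx n).1, (hx n).2, fun i hi => hn ⟨i, hi⟩⟩
  choose R hRS hRc hR using hk
  refine ⟨R, c, hRS, hRc, tendsto_apply_of_tendsto_on_cyclic hRS hRc hw hξ fun i => ?_⟩
  rw [tendsto_iff_dist_tendsto_zero]
  refine squeeze_zero' (Eventually.of_forall fun _ => dist_nonneg) ?_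
    (tendsto_one_div_add_atTop_nhds_zero_nat (𝕜 := ℝ))
  filter_upwards [eventually_gt_atTop i] with k hk
  exact (hR k i hk).le

end Density

section Words

variable {A : Type*} [Ring A] [Algebra ℂ A]

/-- The word in the letters `a`, `b` spelled by a list of Booleans. -/
def letterWord {A : Type*} [Monoid A] (a b : A) (L : List Bool) : A :=
  (L.map fun t => if t then a else b).prod

theorem letterWord_cons {A : Type*} [Monoid A] (a b : A) (d : Bool) (L : List Bool) :
    letterWord a b (d :: L) = (if d then a else b) * letterWord a b L := by
  simp [letterWord]

theorem letterWord_mem_altWords {A : Type*} [Monoid A] (a b : A) {L : List Bool}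
    (hL : L.IsChain (· ≠ ·)) : letterWord a b L ∈ altWords a b := ⟨L, hL, rfl⟩

theorem letter_mul_mem_span_altWords {a b : A} {s t s' t' : ℂ} (ha : a * a = s • a + t • 1)
    (hb : b * b = s' • b + t' • 1) (d : Bool) {x : A}
    (hx : x ∈ Submodule.span ℂ (altWords a b)) :
    (if d then a else b) * x ∈ Submodule.span ℂ (altWords a b) := by
  induction hx using Submodule.span_induction with
  | zero => simp
  | add x y _ _ hx hy => rw [mul_add]; exact Submodule.add_mem _ hx hy
  | smul c x _ hx => rw [mul_smul_comm]; exact Submodule.smul_mem _ c hx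
  | mem x hx =>
    obtain ⟨L, hL : L.IsChain _, rfl⟩ := hx
    change _ * letterWord a b L ∈ _
    cases L with
    | nil =>
      rw [← letterWord_cons]
      exact Submodule.subset_span (letterWord_mem_altWords a b (List.isChain_singleton _))
    | cons e L =>
      by_cases hde : d = e
      · subst hde
        have hsq : ∃ u v : ℂ, (if d then a else b) * (if d then a else b) =
            u • (if d then a else b) + v • 1 := by
          cases d
          · exact ⟨s', t', by simpa using hb⟩
          · exact ⟨s, t, by simpa using ha⟩
        obtain ⟨u, v, huv⟩ := hsq
        rw [letterWord_cons, ← mul_assoc, huv, add_mul, smul_mul_assoc, smul_mul_assoc, one_mul,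
          ← letterWord_cons]
        exact Submodule.add_mem _
          (Submodule.smul_mem _ _ (Submodule.subset_span (letterWord_mem_altWords a b hL)))
          (Submodule.smul_mem _ _ (Submodule.subset_span (letterWord_mem_altWords a b hL.tail)))
      · rw [← letterWord_cons]
        exact Submodule.subset_span (letterWord_mem_altWords a b (hL.cons_cons hde))

theorem algebraAdjoin_le_span_altWords {a b : A} {s t s' t' : ℂ} (ha : a * a = s • a + t • 1)
    (hb : b * b = s' • b + t' • 1) {x : A} (hx : x ∈ Algebra.adjoin ℂ {a, b}) :
    x ∈ Submodule.span ℂ (altWords a b) := by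
  have key : ∀ y ∈ Submodule.span ℂ (altWords a b), x * y ∈ Submodule.span ℂ (altWords a b) := by
    induction hx using Algebra.adjoin_induction with
    | mem x hx =>
      intro y hy
      rcases hx with rfl | rfl
      · simpa using letter_mul_mem_span_altWords ha hb true hy
      · simpa using letter_mul_mem_span_altWords ha hb false hy
    | algebraMap r =>
      intro y hy
      rw [← Algebra.smul_def]
      exact Submodule.smul_mem _ r hy
    | add x y _ _ hx hy =>
      intro z hz
      rw [add_mul]
      exact Submodule.add_mem _ (hx z hz) (hy z hz)
    | mul x y _ _ hx hy =>
      intro z hz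
      rw [mul_assoc]
      exact hx _ (hy z hz)
  simpa using key 1 (Submodule.subset_span ⟨[], List.isChain_nil, by simp⟩)

theorem FreeOn.letterWord_eq_zero {A R : Type*} [Monoid A] [Zero R] {φ : A → R} {S T : Set A}
    (h : FreeOn φ S T) {a b : A} (ha : a ∈ S) (hb : b ∈ T) {L : List Bool} (hL : L ≠ [])
    (hchain : L.IsChain (· ≠ ·)) : φ (letterWord a b L) = 0 := by
  obtain ⟨d, L, rfl⟩ := List.exists_cons_of_ne_nil hL
  have key := h L.length (fun i => if (d :: L)[i] then a else b) (fun i => (d :: L)[i])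
    (fun i => ⟨fun hi => by simpa [hi] using ha, fun hi => by simpa [hi] using hb⟩)
    (fun i => List.isChain_iff_getElem.1 hchain i (by simp))
  have hlist : List.ofFn (fun i : Fin (L.length + 1) => if (d :: L)[i] then a else b) =
      (d :: L).map fun t => if t then a else b := by
    refine List.ext_getElem (by simp) fun i h1 h2 => ?_
    rw [List.getElem_ofFn, List.getElem_map]
    rfl
  rw [hlist] at key
  exact key

theorem mem_span_altWords_diff {φ : A →ₗ[ℂ] ℂ} {S T : Set A} (hφ : φ 1 = 1)
    (h : FreeOn φ S T) {a b : A} (haS : a ∈ S) (hbT : b ∈ T) {s t : ℂ}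
    (ha : a * a = s • a + t • 1) (ht : t ≠ 0) {x : A}
    (hx : x ∈ Submodule.span ℂ (altWords a b)) (hx0 : φ x = 0) (hax0 : φ (a * x) = 0) :
    x ∈ Submodule.span ℂ (altWords a b \ {1, a}) := by
  have hφa : φ a = 0 := by
    simpa [letterWord] using
      h.letterWord_eq_zero haS hbT (List.cons_ne_nil true []) (List.isChain_singleton _)
  have hrest : ∀ r ∈ Submodule.span ℂ (altWords a b \ {1, a}), φ r = 0 ∧ φ (a * r) = 0 := by
    intro r hr
    induction hr using Submodule.span_induction with
    | zero => simp
    | add x y _ _ hx hy => simp [mul_add, hx, hy]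
    | smul c x _ hx => simp [hx]
    | mem x hx =>
      obtain ⟨⟨L, hL : L.IsChain _, rfl⟩, hne⟩ := hx
      change letterWord a b L ∉ _ at hne
      change φ (letterWord a b L) = 0 ∧ φ (a * letterWord a b L) = 0
      have hL0 : L ≠ [] := by
        rintro rfl
        exact hne (by simp [letterWord])
      refine ⟨h.letterWord_eq_zero haS hbT hL0 hL, ?_⟩
      obtain ⟨d, L, rfl⟩ := List.exists_cons_of_ne_nil hL0
      cases d
      · have := h.letterWord_eq_zero haS hbT (List.cons_ne_nil true (false :: L))
          (hL.cons_cons (by simp))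
        rwa [letterWord_cons, if_pos rfl] at this
      · have hL1 : L ≠ [] := by
          rintro rfl
          exact hne (by simp [letterWord])
        have h1 : a * letterWord a b (true :: L) =
            s • letterWord a b (true :: L) + t • letterWord a b L := by
          rw [letterWord_cons, if_pos rfl, ← mul_assoc, ha, add_mul, smul_mul_assoc,
            smul_mul_assoc, one_mul]
        rw [h1, map_add, map_smul, map_smul, h.letterWord_eq_zero haS hbT hL0 hL,
          h.letterWord_eq_zero haS hbT hL1 hL.tail]
        simp
  have hsup : x ∈ Submodule.span ℂ {1, a} ⊔ Submodule.span ℂ (altWords a b \ {1, a}) := by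
    rw [← Submodule.span_union]
    refine Submodule.span_mono (fun y hy => ?_) hx
    by_cases hy' : y ∈ ({1, a} : Set A)
    · exact Or.inl hy'
    · exact Or.inr ⟨hy, hy'⟩
  obtain ⟨y, hy, r, hr, rfl⟩ := Submodule.mem_sup.1 hsup
  obtain ⟨c, d, rfl⟩ := Submodule.mem_span_pair.1 hy
  obtain ⟨hr0, har0⟩ := hrest r hr
  have hc : c = 0 := by simpa [hφ, hφa, hr0] using hx0
  have hd : d = 0 := by simpa [mul_add, hφ, hφa, har0, ha, hc, ht] using hax0
  simpa [hc, hd] using hr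

end Words

/-- Let `p`, `q` be two free projections in `(M, ω)` with `ω(p) = α`,
`ω(q) = β`, let `N = W*(p, q)`, `a = p − α·1`, `b = q − β·1`.  Every `w ∈ N` with
`ω(w) = 0` and `ω(pw) = 0` is the limit, in the strong operator topology, of a
norm-bounded sequence in `span (Λ({a},{b}) ∖ {1, a})`. -/
theorem kaplansky_approximation_in_span_of_traveling_products
    {H : Type*} [NormedAddCommGroup H] [InnerProductSpace ℂ H] [CompleteSpace H]
    (M : VonNeumannAlgebra H)
    (ω : (H →L[ℂ] H) →ₗ[ℂ] ℂ)
    -- `ω` is a faithful normal state on `M`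
    (hω1 : ω 1 = 1)
    (hωpos : ∀ m ∈ M, 0 ≤ ω (star m * m))
    (hωfaith : ∀ m ∈ M, ω (star m * m) = 0 → m = 0)
    (hωnormal : ∀ (w : H →L[ℂ] H) (R : ℕ → H →L[ℂ] H) (c : ℝ),
      w ∈ M → (∀ k, R k ∈ M) → (∀ k, ‖R k‖ ≤ c) →
      (∀ ξ : H, Tendsto (fun k => R k ξ) atTop (𝓝 (w ξ))) →
      Tendsto (fun k => ω (R k)) atTop (𝓝 (ω w)))
    -- the projections `p` and `q`
    (p q : H →L[ℂ] H) (hpM : p ∈ M) (hqM : q ∈ M)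
    (hpstar : star p = p) (hpidem : p * p = p)
    (hqstar : star q = q) (hqidem : q * q = q)
    (α β : ℝ) (hα0 : 0 < α) (hα1 : α < 1) (hβ0 : 0 < β) (hβ1 : β < 1)
    (hωp : ω p = (α : ℂ)) (hωq : ω q = (β : ℂ))
    -- the unital ∗-subalgebras generated by `p` and by `q` are free w.r.t. `ω`
    (hfree : FreeOn ω
      {m | m ∈ Submodule.span ℂ ({1, p} : Set (H →L[ℂ] H)) ∧ ω m = 0}
      {m | m ∈ Submodule.span ℂ ({1, q} : Set (H →L[ℂ] H)) ∧ ω m = 0})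
    -- `N` is the von Neumann subalgebra generated by `p` and `q`
    (N : Set (H →L[ℂ] H)) (hN : N = Set.centralizer (Set.centralizer {p, q}))
    (a b : H →L[ℂ] H) (ha : a = p - (α : ℂ) • 1) (hb : b = q - (β : ℂ) • 1) :
    ∀ w ∈ N, ω w = 0 → ω (p * w) = 0 →
      ∃ (R : ℕ → (H →L[ℂ] H)) (c : ℝ),
        (∀ k, R k ∈ Submodule.span ℂ (altWords a b \ {1, a})) ∧
        (∀ k, ‖R k‖ ≤ c) ∧
        (∀ ξ : H, Tendsto (fun k => R k ξ) atTop (𝓝 (w ξ))) := by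
  subst hN
  set S : StarSubalgebra ℂ (H →L[ℂ] H) := StarAlgebra.adjoin ℂ {p, q} with hS
  intro w hw hw0 hpw0
  have hpqS : {p, q} ⊆ (S : Set (H →L[ℂ] H)) := StarAlgebra.subset_adjoin ℂ _
  have hwS : w ∈ Set.centralizer (Set.centralizer (S : Set (H →L[ℂ] H))) :=
    Set.centralizer_subset (Set.centralizer_subset hpqS) hw
  have hSM : (S : Set (H →L[ℂ] H)) ⊆ M := by
    have : S ≤ M.toStarSubalgebra := StarAlgebra.adjoin_le (by
      rintro x (rfl | rfl)
      exacts [hpM, hqM])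
    exact this
  have hNM : Set.centralizer (Set.centralizer (S : Set (H →L[ℂ] H))) ⊆ M := by
    rw [← M.centralizer_centralizer]
    exact Set.centralizer_subset (Set.centralizer_subset hSM)
  have hsq : ∀ (e : H →L[ℂ] H) (γ : ℝ), e * e = e → (e - (γ : ℂ) • 1) * (e - (γ : ℂ) • 1) =
      (1 - 2 * γ : ℂ) • (e - (γ : ℂ) • 1) + (γ * (1 - γ) : ℂ) • 1 := by
    intro e γ he
    simp only [sub_mul, mul_sub, he, smul_mul_assoc, mul_smul_comm, one_mul, mul_one]
    module
  have ha2 := hsq p α hpidem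
  have hb2 := hsq q β hqidem
  rw [← ha] at ha2
  rw [← hb] at hb2
  have ht : (α * (1 - α) : ℂ) ≠ 0 := by
    have : α * (1 - α) ≠ 0 := by nlinarith [mul_pos hα0 (sub_pos.2 hα1)]
    exact_mod_cast this
  have hpS : p ∈ S := hpqS (by simp)
  have haS : a ∈ S := ha ▸ S.sub_mem hpS (S.smul_mem S.one_mem _)
  have hωa : ω a = 0 := by simp [ha, hωp, hω1]
  have hspan : ∀ x ∈ S, x ∈ Submodule.span ℂ (altWords a b) := by
    intro x hx
    refine algebraAdjoin_le_span_altWords ha2 hb2 ?_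
    have hx' : x ∈ S.toSubalgebra := hx
    rw [hS, StarAlgebra.adjoin_toSubalgebra] at hx'
    refine Algebra.adjoin_le ?_ hx'
    have hpA : p ∈ Algebra.adjoin ℂ {a, b} := by
      have : p = a + (α : ℂ) • 1 := by rw [ha]; abel
      rw [this]
      exact add_mem (Algebra.subset_adjoin (by simp)) (Subalgebra.smul_mem _ (one_mem _) _)
    have hqA : q ∈ Algebra.adjoin ℂ {a, b} := by
      have : q = b + (β : ℂ) • 1 := by rw [hb]; abel
      rw [this]
      exact add_mem (Algebra.subset_adjoin (by simp)) (Subalgebra.smul_mem _ (one_mem _) _)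
    rintro y ((rfl | rfl) | hy)
    · exact hpA
    · exact hqA
    · rcases Set.mem_star.1 hy with h | h
      · rw [star_eq_iff_star_eq, hpstar] at h
        exact h ▸ hpA
      · have h : star y = q := h
        rw [star_eq_iff_star_eq, hqstar] at h
        exact h ▸ hqA
  obtain ⟨R, c, hRS, hRc, hR⟩ := exists_bounded_seq_tendsto S ω
    (fun m hm => hωpos m (hNM hm)) (fun m hm => hωfaith m (hNM hm)) hwS
  have hlim1 : Tendsto (fun k => ω (R k)) atTop (𝓝 0) :=
    hw0 ▸ hωnormal w R c (hNM hwS) (fun k => hSM (hRS k)) hRc hR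
  have hlim2 : Tendsto (fun k => ω (a * R k) / (α * (1 - α) : ℂ)) atTop (𝓝 0) := by
    have haw : ω (a * w) = 0 := by
      rw [ha, sub_mul, map_sub, hpw0, smul_mul_assoc, one_mul, map_smul, hw0]
      simp
    have := hωnormal (a * w) (fun k => a * R k) (‖a‖ * c)
      (mul_mem (hSM haS) (hNM hwS)) (fun k => hSM (S.mul_mem haS (hRS k)))
      (fun k => (norm_mul_le _ _).trans (mul_le_mul_of_nonneg_left (hRc k) (norm_nonneg _)))
      (fun ξ => (a.continuous.tendsto _).comp (hR ξ))
    rw [haw] at this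
    simpa using this.div_const (α * (1 - α) : ℂ)
  obtain ⟨c₁, hc₁⟩ := (hlim1.smul_const (1 : H →L[ℂ] H)).norm.bddAbove_range
  obtain ⟨c₂, hc₂⟩ := (hlim2.smul_const a).norm.bddAbove_range
  refine ⟨fun k => R k - ω (R k) • 1 - (ω (a * R k) / (α * (1 - α) : ℂ)) • a, c + c₁ + c₂,
    fun k => ?_, fun k => ?_, fun ξ => ?_⟩
  · refine mem_span_altWords_diff hω1 hfree ⟨?_, hωa⟩ ⟨?_, ?_⟩ ha2 ht (hspan _ ?_) ?_ ?_
    · rw [ha]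
      exact Submodule.sub_mem _ (Submodule.subset_span (by simp))
        (Submodule.smul_mem _ _ (Submodule.subset_span (by simp)))
    · rw [hb]
      exact Submodule.sub_mem _ (Submodule.subset_span (by simp))
        (Submodule.smul_mem _ _ (Submodule.subset_span (by simp)))
    · simp [hb, hωq, hω1]
    · exact S.sub_mem (S.sub_mem (hRS k) (S.smul_mem S.one_mem _)) (S.smul_mem haS _)
    · simp [hω1, hωa]
    · generalize (α * (1 - α) : ℂ) = t at ha2 ht ⊢
      simp only [mul_sub, mul_smul_comm, mul_one, ha2, map_sub, map_smul, map_add, hωa, hω1,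
        smul_eq_mul, mul_zero, zero_add, sub_zero]
      rw [div_mul_cancel₀ _ ht, sub_self]
  · exact (norm_sub_le _ _).trans (add_le_add ((norm_sub_le _ _).trans
      (add_le_add (hRc k) (hc₁ ⟨k, rfl⟩))) (hc₂ ⟨k, rfl⟩))
  · simpa using ((hR ξ).sub (hlim1.smul_const ξ)).sub (hlim2.smul_const (a ξ))
end

section
/- The family (e_{ij})_{i,j∈ℕ} is a system of matrix units: e_{ij}* = e_{ji} and e_{ij} e_{kl} = δ_{jk} e_{il} for all i, j, k, l ∈ ℕ. -/
theorem mul_pow_mul_of_mul_eq_self {M : Type*} [Monoid M] {p v x : M}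
    (hpv : p * v = v) (hpx : p * x = x) (n : ℕ) : p * (v ^ n * x) = v ^ n * x := by
  cases n with
  | zero => simpa using hpx
  | succ n => rw [pow_succ', mul_assoc v, ← mul_assoc p, hpv]

theorem pow_mul_pow_mul_of_mul_eq_self {M : Type*} [Monoid M] {p v w x : M}
    (hwv : w * v = p) (hpv : p * v = v) (hpx : p * x = x) (n : ℕ) :
    w ^ n * (v ^ n * x) = x := by
  induction n with
  | zero => simp
  | succ n ih =>
    rw [pow_succ, pow_succ', mul_assoc v, mul_assoc (w ^ n), ← mul_assoc w, hwv,
      mul_pow_mul_of_mul_eq_self hpv hpx, ih]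

theorem mul_star_pow_mul_pow_mul {R : Type*} [Semiring R] [StarRing R] {p q v : R}
    (hvv : star v * v = p) (hpv : p * v = v) (hq : star q = q) (hqq : q * q = q)
    (hpq : p * q = q) (hqv : q * v = 0) (j k : ℕ) :
    q * (star v ^ j * (v ^ k * q)) = if j = k then q else 0 := by
  have below (j m : ℕ) : q * (star v ^ j * (v ^ (j + (m + 1)) * q)) = 0 := by
    have hpx : p * (v ^ (m + 1) * q) = v ^ (m + 1) * q :=
      mul_pow_mul_of_mul_eq_self hpv hpq _
    rw [pow_add, mul_assoc (v ^ j), pow_mul_pow_mul_of_mul_eq_self hvv hpv hpx,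
      pow_succ', mul_assoc v, ← mul_assoc q, hqv, zero_mul]
  rcases lt_trichotomy j k with h | rfl | h
  · obtain ⟨m, rfl⟩ := Nat.exists_eq_add_of_lt h
    rw [if_neg h.ne]
    exact below j m
  · rw [if_pos rfl, pow_mul_pow_mul_of_mul_eq_self hvv hpv hpq, hqq]
  · obtain ⟨m, rfl⟩ := Nat.exists_eq_add_of_lt h
    rw [if_neg h.ne']
    simpa [hq, mul_assoc, add_assoc] using congrArg star (below k m)

/-- Let `p, P` be projections in a unital C*-algebra with `P ≤ p`, and
let `v` satisfy `v*v = p` and `Pv = v`.  Then the family `e_{ij} = vⁱ (p − P) (v*)ʲ`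
is a system of matrix units: `e_{ij}* = e_{ji}` and `e_{ij} e_{kl} = δ_{jk} e_{il}`. -/
theorem matrix_units_from_isometry_first_family
    {A : Type*} [CStarAlgebra A]
    (p P v : A)
    (hpstar : star p = p) (hpidem : p * p = p)
    (hPstar : star P = P) (hPidem : P * P = P)
    (hpP : p * P = P) (hPp : P * p = P)
    (hvv : star v * v = p) (hPv : P * v = v)
    (e : ℕ → ℕ → A) (he : ∀ i j, e i j = v ^ i * (p - P) * (star v) ^ j) :
    (∀ i j, star (e i j) = e j i) ∧
    (∀ i j k l, e i j * e k l = if j = k then e i l else 0) := by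
  have hpv : p * v = v := by rw [← hPv, ← mul_assoc, hpP]
  have hq : star (p - P) = p - P := by rw [star_sub, hpstar, hPstar]
  have hpq : p * (p - P) = p - P := by rw [mul_sub, hpidem, hpP]
  have hqq : (p - P) * (p - P) = p - P := by
    rw [sub_mul, hpq, mul_sub, hPp, hPidem, sub_self, sub_zero]
  have hqv : (p - P) * v = 0 := by rw [sub_mul, hpv, hPv, sub_self]
  refine ⟨fun i j => ?_, fun i j k l => ?_⟩
  · rw [he, he, star_mul, star_mul, star_pow, star_pow, star_star, hq, mul_assoc]
  · calc
      e i j * e k l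
          = v ^ i * ((p - P) * (star v ^ j * (v ^ k * (p - P)))) * star v ^ l := by
        simp only [he, mul_assoc]
      _ = if j = k then e i l else 0 := by
        rw [mul_star_pow_mul_pow_mul hvv hpv hq hqq hpq hqv, he]
        split_ifs <;> simp
end

section
/- The two systems of matrix units annihilate each other: e_{ij} f_{kl} = 0 and f_{kl} e_{ij} = 0 for all i, j, k, l ∈ ℕ. -/
/-- If `s * v` acts as a left identity on `v` and `b`, and `a * b`, `a * v`, `s * b` vanish,
then `a * s ^ j * v ^ k * b` vanishes for all `j` and `k`. -/
theorem mul_pow_mul_pow_mul_eq_zero {R : Type*} [Semiring R] {a b s v : R}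
    (hab : a * b = 0) (hav : a * v = 0) (hsb : s * b = 0)
    (hv : s * v * v = v) (hb : s * v * b = b) (j k : ℕ) :
    a * s ^ j * v ^ k * b = 0 := by
  induction j generalizing k with
  | zero =>
    cases k with
    | zero => simpa using hab
    | succ k => rw [pow_zero, mul_one, pow_succ', ← mul_assoc, hav, zero_mul, zero_mul]
  | succ j ih =>
    cases k with
    | zero => rw [pow_zero, mul_one, pow_succ, mul_assoc, mul_assoc, hsb, mul_zero, mul_zero]
    | succ k =>
      have h : s * v * (v ^ k * b) = v ^ k * b := by
        cases k with
        | zero => simpa using hb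
        | succ k => rw [pow_succ', mul_assoc v, ← mul_assoc (s * v), hv]
      calc a * s ^ (j + 1) * v ^ (k + 1) * b
          = a * s ^ j * (s * v * (v ^ k * b)) := by
            rw [pow_succ, pow_succ']
            simp only [mul_assoc]
        _ = 0 := by rw [h, ← mul_assoc, ih k]


/-- Let `p, P` be projections in a unital C*-algebra with `P ≤ p`, and
let `v` satisfy `v*v = p` and `Pv = v`.  Then the two systems of matrix units
`e_{ij} = vⁱ (p − P) (v*)ʲ` and `f_{kl} = vᵏ (P − vv*) (v*)ˡ` annihilate each other:
`e_{ij} f_{kl} = 0 = f_{kl} e_{ij}`. -/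
theorem matrix_units_from_isometry_orthogonal_families
    {A : Type*} [CStarAlgebra A]
    (p P v : A)
    (hpstar : star p = p) (hpidem : p * p = p)
    (hPstar : star P = P) (hPidem : P * P = P)
    (hpP : p * P = P) (hPp : P * p = P)
    (hvv : star v * v = p) (hPv : P * v = v)
    (e f : ℕ → ℕ → A)
    (he : ∀ i j, e i j = v ^ i * (p - P) * (star v) ^ j)
    (hf : ∀ k l, f k l = v ^ k * (P - v * star v) * (star v) ^ l) :
    ∀ i j k l, e i j * f k l = 0 ∧ f k l * e i j = 0 := by
  have hpv : p * v = v := by rw [← hPv, ← mul_assoc, hpP]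
  have hvp : v * p = v := by
    rw [← sub_eq_zero, ← CStarRing.star_mul_self_eq_zero_iff]
    simp only [star_sub, star_mul, hpstar, sub_mul, mul_sub]
    simp only [mul_assoc, hvv, hpidem]
    simp only [← mul_assoc, hvv, hpidem]
    simp
  have hDv : (p - P) * v = 0 := by rw [sub_mul, hpv, hPv, sub_self]
  have hEv : (P - v * star v) * v = 0 := by rw [sub_mul, hPv, mul_assoc, hvv, hvp, sub_self]
  have hsD : star v * (p - P) = 0 := by
    simpa [hpstar, hPstar] using congrArg star hDv
  have hsE : star v * (P - v * star v) = 0 := by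
    simpa [hPstar] using congrArg star hEv
  have hDE : (p - P) * (P - v * star v) = 0 := by
    rw [mul_sub, ← mul_assoc, hDv, zero_mul, sub_zero, sub_mul, hpP, hPidem, sub_self]
  have hED : (P - v * star v) * (p - P) = 0 := by
    rw [sub_mul, mul_assoc, hsD, mul_zero, sub_zero, mul_sub, hPp, hPidem, sub_self]
  have hpv' : star v * v * v = v := by rw [hvv, hpv]
  have hpD : star v * v * (p - P) = p - P := by rw [hvv, mul_sub, hpidem, hpP]
  have hpE : star v * v * (P - v * star v) = P - v * star v := by
    rw [hvv, mul_sub, hpP, ← mul_assoc, hpv]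
  intro i j k l
  rw [he, hf]
  constructor
  · calc _ = v ^ i * ((p - P) * star v ^ j * v ^ k * (P - v * star v)) * star v ^ l := by
          simp only [mul_assoc]
      _ = 0 := by
          rw [mul_pow_mul_pow_mul_eq_zero hDE hDv hsE hpv' hpE, mul_zero, zero_mul]
  · calc _ = v ^ k * ((P - v * star v) * star v ^ l * v ^ i * (p - P)) * star v ^ j := by
          simp only [mul_assoc]
      _ = 0 := by
          rw [mul_pow_mul_pow_mul_eq_zero hED hEv hsD hpv' hpD, mul_zero, zero_mul]
end
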